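/- arXiv:1308.3604 — 3 statements merged into one kernel-verified Lean document; each statement's English description precedes it below -/
import Mathlib

section
/- Let N ≥ 1 be an integer and p a prime with p > 2N. Let x ∈ gl(N,ℤ_p) be residually nilpotent, let y ∈ gl(N,ℤ_p) be arbitrary, and let n ≥ 1 be an integer. Then x + p^n·y is residually nilpotent, the series exp(x + p^n·y) and exp(x) converge p-adically with sums in GL(N,ℤ_p), and exp(x + p^n·y) ≡ exp(x) (mod p^n). -/
/-- The exponential series `∑ zᵏ/k!` of a square matrix over `ℚ_[p]`. -/
noncomputable def matExp {p : ℕ} [Fact p.Prime] {N : ℕ}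
    (z : Matrix (Fin N) (Fin N) ℚ_[p]) : Matrix (Fin N) (Fin N) ℚ_[p] :=
  ∑' k : ℕ, ((k.factorial : ℚ_[p]))⁻¹ • z ^ k

/-- The coefficient-wise coercion of a matrix over `ℤ_[p]` to a matrix over `ℚ_[p]`. -/
def matQ {p : ℕ} [Fact p.Prime] {N : ℕ}
    (x : Matrix (Fin N) (Fin N) ℤ_[p]) : Matrix (Fin N) (Fin N) ℚ_[p] :=
  x.map (fun a => (a : ℚ_[p]))

/-- `x ∈ gl(N, ℤ_[p])` is residually nilpotent. -/
def ResNilp {p : ℕ} [Fact p.Prime] {N : ℕ} (x : Matrix (Fin N) (Fin N) ℤ_[p]) : Prop :=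
  ∃ m : ℕ, 1 ≤ m ∧ ∀ i j, (p : ℤ_[p]) ∣ (x ^ m) i j

namespace S10

variable {p : ℕ} [hpF : Fact p.Prime] {N : ℕ}

/-- Reduction mod p. -/
noncomputable def red : Matrix (Fin N) (Fin N) ℤ_[p] →+* Matrix (Fin N) (Fin N) (ZMod p) :=
  (PadicInt.toZMod (p := p)).mapMatrix

/-- Coefficient embedding as a ring hom. -/
noncomputable def emb : Matrix (Fin N) (Fin N) ℤ_[p] →+* Matrix (Fin N) (Fin N) ℚ_[p] :=
  (PadicInt.Coe.ringHom (p := p)).mapMatrix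

lemma emb_eq (x : Matrix (Fin N) (Fin N) ℤ_[p]) : matQ x = emb x := rfl

lemma toZMod_eq_zero_iff (z : ℤ_[p]) : PadicInt.toZMod z = 0 ↔ (p : ℤ_[p]) ∣ z := by
  rw [← RingHom.mem_ker, PadicInt.ker_toZMod, PadicInt.maximalIdeal_eq_span_p,
    Ideal.mem_span_singleton]

lemma red_eq_zero_iff (x : Matrix (Fin N) (Fin N) ℤ_[p]) :
    red x = 0 ↔ ∀ i j, (p : ℤ_[p]) ∣ x i j := by
  constructor
  · intro h i j
    rw [← toZMod_eq_zero_iff]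
    exact congrFun (congrFun h i) j
  · intro h
    ext i j
    exact (toZMod_eq_zero_iff _).2 (h i j)

lemma resNilp_iff (x : Matrix (Fin N) (Fin N) ℤ_[p]) : ResNilp x ↔ IsNilpotent (red x) := by
  constructor
  · rintro ⟨m, -, h⟩
    exact ⟨m, by rw [← map_pow, red_eq_zero_iff]; exact h⟩
  · rintro ⟨m, h⟩
    refine ⟨m + 1, by omega, ?_⟩
    rw [← red_eq_zero_iff, map_pow, pow_succ, h, zero_mul]

lemma red_pow (x : Matrix (Fin N) (Fin N) ℤ_[p]) (hx : ResNilp x) : red x ^ N = 0 := by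
  rw [resNilp_iff] at hx
  have h := Matrix.isNilpotent_charpoly_sub_pow_of_isNilpotent hx
  have h2 := sub_eq_zero.1 h.eq_zero
  have h3 := Matrix.aeval_self_charpoly (red x)
  rw [h2] at h3
  simpa using h3

lemma exists_smul (x : Matrix (Fin N) (Fin N) ℤ_[p]) (hx : red x = 0) :
    ∃ q, x = (p : ℤ_[p]) • q := by
  rw [red_eq_zero_iff] at hx
  choose q hq using hx
  exact ⟨Matrix.of q, by ext i j; simp [hq i j]⟩

lemma pow_form (x : Matrix (Fin N) (Fin N) ℤ_[p]) (hx : ResNilp x) (k : ℕ) :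
    ∃ q, x ^ k = (p : ℤ_[p]) ^ (k / N) • q := by
  obtain ⟨q, hq⟩ := exists_smul (x ^ N) (by rw [map_pow, red_pow x hx])
  refine ⟨q ^ (k / N) * x ^ (k % N), ?_⟩
  conv_lhs => rw [← Nat.div_add_mod k N, pow_add, pow_mul, hq, smul_pow]
  rw [smul_mul_assoc]

lemma fact_dvd (hN : 1 ≤ N) (hp : 2 * N < p) (k : ℕ) :
    ((k + 1).factorial : ℤ_[p]) ∣ (p : ℤ_[p]) ^ (k / (2 * N)) := by
  have h1 := sub_one_mul_padicValNat_factorial_lt_of_ne_zero p (n := k + 1) (by omega)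
  set v := padicValNat p (k + 1).factorial with hv
  have h2 : v ≤ k / (2 * N) := by
    rw [Nat.le_div_iff_mul_le (by omega)]
    have : v * (2 * N) ≤ v * (p - 1) := Nat.mul_le_mul_left _ (by omega)
    rw [mul_comm] at h1
    omega
  have h3 : ((k + 1).factorial : ℤ_[p]) ≠ 0 := by
    exact_mod_cast (k + 1).factorial_ne_zero
  have h4 : ((k + 1).factorial : ℤ_[p]).valuation = v := by
    have := PadicInt.valuation_coe ((k + 1).factorial : ℤ_[p])
    rw [PadicInt.coe_natCast, Padic.valuation_natCast] at this
    exact_mod_cast this.symm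
  rw [PadicInt.unitCoeff_spec h3, h4]
  refine (Units.isUnit _).mul_left_dvd.2 (pow_dvd_pow _ h2)

lemma exists_d (hN : 1 ≤ N) (hp : 2 * N < p) (x : Matrix (Fin N) (Fin N) ℤ_[p])
    (hx : ResNilp x) (k : ℕ) :
    ∃ d q : Matrix (Fin N) (Fin N) ℤ_[p], ((k + 1).factorial : ℤ_[p]) • d = x ^ k ∧
      d = (p : ℤ_[p]) ^ (k / (2 * N)) • q := by
  obtain ⟨q, hq⟩ := pow_form x hx k
  obtain ⟨t, ht⟩ := fact_dvd hN hp k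
  have hle : k / (2 * N) + k / (2 * N) ≤ k / N := by
    rw [Nat.le_div_iff_mul_le (by omega)]
    have := Nat.div_mul_le_self k (2 * N)
    nlinarith
  obtain ⟨e, he⟩ := Nat.exists_eq_add_of_le hle
  refine ⟨(p : ℤ_[p]) ^ (k / (2 * N)) • (((p : ℤ_[p]) ^ e * t) • q), _, ?_, rfl⟩
  rw [hq, he, smul_smul, smul_smul, pow_add, pow_add]
  congr 1
  nth_rewrite 3 [ht]
  ring

lemma smul_inj {c : ℤ_[p]} (hc : c ≠ 0) {a b : Matrix (Fin N) (Fin N) ℤ_[p]}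
    (h : c • a = c • b) : a = b := by
  ext i j
  have := congrFun (congrFun h i) j
  simp only [Matrix.smul_apply, smul_eq_mul] at this
  rw [mul_left_cancel₀ hc this]

lemma norm_le_of_dvd {z : ℤ_[p]} {m : ℕ} (h : (p : ℤ_[p]) ^ m ∣ z) :
    ‖z‖ ≤ (p : ℝ) ^ (-(m : ℤ)) := by
  rw [PadicInt.norm_le_pow_iff_mem_span_pow, Ideal.mem_span_singleton]
  exact h

lemma summable_d (hN : 1 ≤ N) (d q : ℕ → Matrix (Fin N) (Fin N) ℤ_[p])
    (h : ∀ k, d k = (p : ℤ_[p]) ^ (k / (2 * N)) • q k) : Summable d := by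
  refine Pi.summable.2 fun i => Pi.summable.2 fun j => ?_
  apply NonarchimedeanAddGroup.summable_of_tendsto_cofinite_zero
  rw [Nat.cofinite_eq_atTop]
  have hp1 : (1 : ℝ) < p := by exact_mod_cast hpF.out.one_lt
  have ht : Filter.Tendsto (fun k : ℕ => ((p : ℝ)⁻¹) ^ (k / (2 * N))) Filter.atTop (nhds 0) :=
    (tendsto_pow_atTop_nhds_zero_of_lt_one (by positivity) (inv_lt_one_of_one_lt₀ hp1)).comp
      (Nat.tendsto_div_const_atTop (by omega))
  refine squeeze_zero_norm (fun k => ?_) ht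
  have := norm_le_of_dvd (z := d k i j) (m := k / (2 * N)) ⟨q k i j, by rw [h]; rfl⟩
  rw [inv_pow, ← zpow_natCast, ← zpow_neg]
  exact this

lemma emb_cont : Continuous (emb (p := p) (N := N)) := by
  refine continuous_pi fun i => continuous_pi fun j => ?_
  exact continuous_subtype_val.comp (continuous_apply_apply i j)

lemma main (hN : 1 ≤ N) (hp : 2 * N < p) (x : Matrix (Fin N) (Fin N) ℤ_[p])
    (hx : ResNilp x) :
    ∃ d : ℕ → Matrix (Fin N) (Fin N) ℤ_[p],
      (∀ k, ((k + 1).factorial : ℤ_[p]) • d k = x ^ k) ∧ Summable d ∧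
      IsUnit (1 + x * ∑' k, d k) ∧
      HasSum (fun k : ℕ => ((k.factorial : ℚ_[p]))⁻¹ • (matQ x) ^ k)
        (matQ (1 + x * ∑' k, d k)) := by
  choose d q hd hq using exists_d hN hp x hx
  have hs := summable_d hN d q hq
  refine ⟨d, hd, hs, ?_, ?_⟩
  · have hc : Commute x (∑' k, d k) := by
      have : ∀ k, Commute x (d k) := by
        intro k
        have h3 : ((k + 1).factorial : ℤ_[p]) ≠ 0 := by
          exact_mod_cast (k + 1).factorial_ne_zero
        apply smul_inj h3
        rw [← mul_smul_comm, ← smul_mul_assoc, hd, (Commute.self_pow x k).eq]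
      exact Commute.tsum_right x this
    have hn : IsNilpotent (red (x * ∑' k, d k)) := by
      rw [map_mul]
      exact Commute.isNilpotent_mul_right (hc.map red) ((resNilp_iff x).1 hx)
    have hu : IsUnit (red (1 + x * ∑' k, d k)) := by
      rw [map_add, map_one]
      exact hn.isUnit_one_add
    rw [Matrix.isUnit_iff_isUnit_det] at hu ⊢
    have hl : IsLocalHom (PadicInt.toZMod (p := p)) :=
      IsLocalHom.of_surjective _ (ZMod.ringHom_surjective _)
    apply hl.map_nonunit
    rw [RingHom.map_det]
    exact hu
  · rw [← hasSum_nat_add_iff' 1]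
    have h1 : HasSum (fun k => emb (x * d k)) (emb (x * ∑' k, d k)) :=
      (hs.hasSum.mul_left x).map emb emb_cont
    have e1 : (fun k : ℕ => (((k + 1).factorial : ℚ_[p]))⁻¹ • (matQ x) ^ (k + 1))
        = fun k => emb (x * d k) := by
      funext k
      have h3 : ((k + 1).factorial : ℚ_[p]) ≠ 0 := by
        exact_mod_cast (k + 1).factorial_ne_zero
      rw [inv_smul_eq_iff₀ h3, emb_eq, ← map_pow, pow_succ', ← hd k, mul_smul_comm]
      generalize x * d k = z
      ext i j
      simp [emb]
    have e2 : matQ (1 + x * ∑' k, d k) -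
        ∑ i ∈ Finset.range 1, ((i.factorial : ℚ_[p]))⁻¹ • (matQ x) ^ i
        = emb (x * ∑' k, d k) := by
      simp [emb_eq]
    rw [e2, e1]
    exact h1

lemma diff_form (hN : 1 ≤ N) (a x y : Matrix (Fin N) (Fin N) ℤ_[p])
    (ha : ResNilp a) (hx : ResNilp x) (n : ℕ) (h : a = x + (p : ℤ_[p]) ^ n • y) (k : ℕ) :
    ∃ r, a ^ (k + 1) - x ^ (k + 1) = ((p : ℤ_[p]) ^ n * (p : ℤ_[p]) ^ (k / (2 * N))) • r := by
  have tele : ∀ m : ℕ, a ^ m - x ^ m =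
      ∑ i ∈ Finset.range m, a ^ i * (a - x) * x ^ (m - 1 - i) := by
    intro m
    induction m with
    | zero => simp
    | succ m ih =>
      rw [Finset.sum_range_succ]
      have : ∑ i ∈ Finset.range m, a ^ i * (a - x) * x ^ (m + 1 - 1 - i)
          = (∑ i ∈ Finset.range m, a ^ i * (a - x) * x ^ (m - 1 - i)) * x := by
        rw [Finset.sum_mul]
        refine Finset.sum_congr rfl fun i hi => ?_
        rw [Finset.mem_range] at hi
        rw [show m + 1 - 1 - i = (m - 1 - i) + 1 by omega, pow_succ, mul_assoc, mul_assoc,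
          mul_assoc]
      rw [this, ← ih]
      simp only [add_tsub_cancel_right, tsub_self, pow_zero, mul_one, pow_succ]
      noncomm_ring
  have term : ∀ i, ∃ r, i ∈ Finset.range (k + 1) → a ^ i * (a - x) * x ^ (k + 1 - 1 - i) =
      ((p : ℤ_[p]) ^ n * (p : ℤ_[p]) ^ (k / (2 * N))) • r := by
    intro i
    by_cases hi : i ∈ Finset.range (k + 1)
    swap
    · exact ⟨0, fun h => absurd h hi⟩
    rw [Finset.mem_range] at hi
    obtain ⟨q1, h1⟩ := pow_form a ha i
    obtain ⟨q2, h2⟩ := pow_form x hx (k + 1 - 1 - i)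
    have hle : k / (2 * N) ≤ i / N + (k + 1 - 1 - i) / N := by
      generalize hj : k + 1 - 1 - i = j
      have hk : k = i + j := by omega
      have e1 := Nat.div_add_mod i N
      have e2 := Nat.div_add_mod j N
      have e3 := Nat.mod_lt i (show N > 0 by omega)
      have e4 := Nat.mod_lt j (show N > 0 by omega)
      by_cases h0 : k / (2 * N) = 0
      · rw [h0]; exact Nat.zero_le _
      have e5 := Nat.mul_div_le k (2 * N)
      set A := i / N
      set B := j / N
      set Q := k / (2 * N)
      by_contra hlt
      have hh : N * (A + B + 2) ≤ N * (2 * Q) := Nat.mul_le_mul_left _ (by omega)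
      nlinarith
    obtain ⟨e, he⟩ := Nat.exists_eq_add_of_le hle
    refine ⟨(p : ℤ_[p]) ^ e • (q1 * y * q2), fun _ => ?_⟩
    rw [h1, h2, show a - x = (p : ℤ_[p]) ^ n • y by rw [h]; abel]
    simp only [smul_mul_assoc, mul_smul_comm, smul_smul]
    congr 1
    rw [mul_assoc _ _ ((p : ℤ_[p]) ^ e), ← pow_add _ _ e, ← he, pow_add]
    ring
  choose r hr using term
  refine ⟨∑ i ∈ Finset.range (k + 1), r i, ?_⟩
  rw [tele, Finset.smul_sum]
  exact Finset.sum_congr rfl fun i hi => hr i hi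

end S10

/-- **Lemma (exp congruence for residually nilpotent matrices).**
Let `N ≥ 1`, `p > 2N`, `x ∈ gl(N, ℤ_[p])` residually nilpotent, `y ∈ gl(N, ℤ_[p])`
arbitrary, and `n ≥ 1`. Then `x + pⁿ y` is residually nilpotent, the series
`exp (x + pⁿ y)` and `exp x` converge with sums in `GL(N, ℤ_[p])`, and
`exp (x + pⁿ y) ≡ exp x (mod pⁿ)`. -/
theorem stmt_10 (N : ℕ) (hN : 1 ≤ N) (p : ℕ) [Fact p.Prime] (hp : 2 * N < p)
    (x y : Matrix (Fin N) (Fin N) ℤ_[p]) (hx : ResNilp x) (n : ℕ) (hn : 1 ≤ n) :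
    ResNilp (x + (p : ℤ_[p]) ^ n • y) ∧
    Summable (fun k : ℕ =>
      ((k.factorial : ℚ_[p]))⁻¹ • (matQ (x + (p : ℤ_[p]) ^ n • y)) ^ k) ∧
    Summable (fun k : ℕ => ((k.factorial : ℚ_[p]))⁻¹ • (matQ x) ^ k) ∧
    (∃ u : Matrix (Fin N) (Fin N) ℤ_[p], IsUnit u ∧
      matQ u = matExp (matQ (x + (p : ℤ_[p]) ^ n • y))) ∧
    (∃ v : Matrix (Fin N) (Fin N) ℤ_[p], IsUnit v ∧ matQ v = matExp (matQ x)) ∧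
    (∀ i j, ‖matExp (matQ (x + (p : ℤ_[p]) ^ n • y)) i j - matExp (matQ x) i j‖
      ≤ (p : ℝ) ^ (-(n : ℤ))) := by
  have hxn := (S10.resNilp_iff x).1 hx
  have ha : ResNilp (x + (p : ℤ_[p]) ^ n • y) := by
    rw [S10.resNilp_iff, map_add]
    have : S10.red ((p : ℤ_[p]) ^ n • y) = 0 := by
      rw [S10.red_eq_zero_iff]
      intro i j
      exact Dvd.dvd.mul_right (dvd_pow_self _ (by omega)) _
    rw [this, add_zero]
    exact hxn
  obtain ⟨d, hd, hds, hdu, hdh⟩ := S10.main hN hp x hx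
  obtain ⟨c, hc, hcs, hcu, hch⟩ := S10.main hN hp _ ha
  refine ⟨ha, hch.summable, hdh.summable, ⟨_, hcu, hch.tsum_eq.symm⟩,
    ⟨_, hdu, hdh.tsum_eq.symm⟩, ?_⟩
  intro i j
  have e1 : matExp (matQ (x + (p : ℤ_[p]) ^ n • y)) = _ := hch.tsum_eq
  have e2 : matExp (matQ x) = _ := hdh.tsum_eq
  rw [e1, e2]
  have key : ∀ k, ‖((x + (p : ℤ_[p]) ^ n • y) * c k - x * d k) i j‖ ≤ (p : ℝ) ^ (-(n : ℤ)) := by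
    intro k
    obtain ⟨r, hr⟩ := S10.diff_form hN _ x y ha hx n rfl k
    obtain ⟨t, ht⟩ := S10.fact_dvd hN hp k
    have h3 : ((k + 1).factorial : ℤ_[p]) ≠ 0 := by
      exact_mod_cast (k + 1).factorial_ne_zero
    have : (x + (p : ℤ_[p]) ^ n • y) * c k - x * d k = ((p : ℤ_[p]) ^ n * t) • r := by
      apply S10.smul_inj h3
      rw [smul_sub, ← mul_smul_comm, ← mul_smul_comm, hc, hd, ← pow_succ', ← pow_succ', hr, ht,
        smul_smul]
      congr 1
      ring
    rw [this]
    apply S10.norm_le_of_dvd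
    exact ⟨t * r i j, by simp [mul_assoc]⟩
  have hsum : HasSum (fun k => ((x + (p : ℤ_[p]) ^ n • y) * c k - x * d k) i j)
      (((x + (p : ℤ_[p]) ^ n • y) * ∑' k, c k - x * ∑' k, d k) i j) :=
    Pi.hasSum.1 (Pi.hasSum.1 ((hcs.hasSum.mul_left _).sub (hds.hasSum.mul_left x)) i) j
  have hfin : ‖((x + (p : ℤ_[p]) ^ n • y) * ∑' k, c k - x * ∑' k, d k) i j‖
      ≤ (p : ℝ) ^ (-(n : ℤ)) := by
    rw [← hsum.tsum_eq]
    exact (IsUltrametricDist.norm_tsum_le _).trans (ciSup_le key)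
  refine le_trans (le_of_eq ?_) hfin
  rw [PadicInt.norm_def]
  congr 1
  simp [matQ, Matrix.map_apply]
end

section
/- Let N ≥ 1 be an integer and p a prime with p > 2N and p > N² + 1. Let H be a subgroup of GL(N,ℤ_p). Then the ℤ_p-submodule of gl(N,ℤ_p) generated by the set { log h : h ∈ H, h residually unipotent } is a Lie subalgebra of gl(N,ℤ_p), i.e., it is closed under the Lie bracket [x,y] = xy − yx. -/
/-- The logarithm series `-∑_{k ≥ 1} (1 - z)ᵏ/k` of a square matrix over `ℚ_[p]`. -/
noncomputable def matLog {p : ℕ} [Fact p.Prime] {N : ℕ}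
    (z : Matrix (Fin N) (Fin N) ℚ_[p]) : Matrix (Fin N) (Fin N) ℚ_[p] :=
  -∑' k : ℕ, ((k : ℚ_[p]))⁻¹ • (1 - z) ^ k

/-- `u` is a residually unipotent element of `GL(N, ℤ_[p])`. -/
def ResUnip {p : ℕ} [Fact p.Prime] {N : ℕ} (u : Matrix (Fin N) (Fin N) ℤ_[p]) : Prop :=
  IsUnit u ∧ ∃ m : ℕ, ∀ i j, (p : ℤ_[p]) ∣ (u ^ (p ^ m) - 1) i j

open Filter Topology

lemma aux_val {p : ℕ} [hp : Fact p.Prime] {d k : ℕ} (hd : 1 ≤ d) (hdp : d < p) (hk : k ≠ 0) :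
    (k : ℤ_[p]) ∣ (p : ℤ_[p]) ^ (k / d) := by
  obtain ⟨v, m, hm, rfl⟩ := Nat.exists_eq_pow_mul_and_not_dvd hk p hp.out.ne_one
  have hu : IsUnit (m : ℤ_[p]) := by
    rw [PadicInt.isUnit_iff, PadicInt.norm_natCast_eq_one_iff]
    exact (Nat.Prime.coprime_iff_not_dvd hp.out).2 hm
  push_cast
  rw [hu.mul_right_dvd]
  apply pow_dvd_pow
  rw [Nat.le_div_iff_mul_le (by omega)]
  have hm1 : 1 ≤ m := by
    rcases Nat.eq_zero_or_pos m with h | h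
    · simp [h] at hm
    · exact h
  rcases Nat.eq_zero_or_pos v with h | h
  · simp [h]
  · obtain ⟨w, rfl⟩ : ∃ w, v = w + 1 := ⟨v - 1, by omega⟩
    have h1 : w < p ^ w := Nat.lt_pow_self hp.out.one_lt
    calc (w + 1) * d ≤ p ^ w * p := Nat.mul_le_mul h1 hdp.le
      _ = p ^ (w + 1) := by rw [pow_succ]
      _ ≤ p ^ (w + 1) * m := Nat.le_mul_of_pos_right _ hm1

lemma aux_toZMod {p : ℕ} [hp : Fact p.Prime] (x : ℤ_[p]) :
    PadicInt.toZMod x = 0 ↔ (p : ℤ_[p]) ∣ x := by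
  rw [← RingHom.mem_ker, PadicInt.ker_toZMod, PadicInt.maximalIdeal_eq_span_p,
    Ideal.mem_span_singleton]

lemma aux_map {p : ℕ} [hp : Fact p.Prime] {ι : Type*} (X : Matrix ι ι ℤ_[p]) :
    X.map PadicInt.toZMod = 0 ↔ ∃ Y : Matrix ι ι ℤ_[p], X = (p : ℤ_[p]) • Y := by
  constructor
  · intro h
    have : ∀ i j, (p : ℤ_[p]) ∣ X i j := fun i j => by
      rw [← aux_toZMod]; exact congrFun (congrFun h i) j
    choose Y hY using this
    exact ⟨Matrix.of Y, by ext i j; simp [hY i j]⟩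
  · rintro ⟨Y, rfl⟩
    ext i j
    simp

/-- binomial mod p -/
lemma aux_nilp {p : ℕ} [hp : Fact p.Prime] {ι : Type*} [Fintype ι] [DecidableEq ι]
    (U : Matrix ι ι ℤ_[p]) (m : ℕ)
    (h : ∃ Y : Matrix ι ι ℤ_[p], U ^ (p ^ m) - 1 = (p : ℤ_[p]) • Y) :
    ∃ Y : Matrix ι ι ℤ_[p], (U - 1) ^ (p ^ m) = (p : ℤ_[p]) • Y := by
  rcases isEmpty_or_nonempty ι with hi | hi
  · exact ⟨0, Subsingleton.elim _ _⟩
  rw [← aux_map] at h ⊢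
  have e : ∀ X : Matrix ι ι ℤ_[p], X.map PadicInt.toZMod =
    (PadicInt.toZMod (p := p)).mapMatrix X := fun _ => rfl
  rw [e] at h ⊢
  rw [map_sub, map_pow, map_one] at h
  rw [map_pow, map_sub, map_one, sub_pow_char_pow_of_commute p m (Commute.one_right _), one_pow, h]

lemma aux_card {p : ℕ} [hp : Fact p.Prime] {ι : Type*} [Fintype ι] [DecidableEq ι]
    (D : Matrix ι ι ℤ_[p]) (n : ℕ)
    (h : ∃ Y : Matrix ι ι ℤ_[p], D ^ n = (p : ℤ_[p]) • Y) :
    ∃ Y : Matrix ι ι ℤ_[p], D ^ (Fintype.card ι) = (p : ℤ_[p]) • Y := by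
  rw [← aux_map] at h ⊢
  have e : ∀ X : Matrix ι ι ℤ_[p], X.map PadicInt.toZMod =
    (PadicInt.toZMod (p := p)).mapMatrix X := fun _ => rfl
  rw [e, map_pow] at h ⊢
  have h1 := Matrix.isNilpotent_charpoly_sub_pow_of_isNilpotent ⟨n, h⟩
  have h2 := sub_eq_zero.1 h1.eq_zero
  have h3 := Matrix.aeval_self_charpoly ((PadicInt.toZMod (p := p)).mapMatrix D)
  rw [h2] at h3
  simpa using h3

lemma aux_pow {p : ℕ} [hp : Fact p.Prime] {ι : Type*} [Fintype ι] [DecidableEq ι]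
    (D : Matrix ι ι ℤ_[p]) (n : ℕ)
    (h : ∃ Y : Matrix ι ι ℤ_[p], D ^ n = (p : ℤ_[p]) • Y) (k : ℕ) :
    ∃ Y : Matrix ι ι ℤ_[p], D ^ k = (p : ℤ_[p]) ^ (k / n) • Y := by
  obtain ⟨Y, hY⟩ := h
  refine ⟨Y ^ (k / n) * D ^ (k % n), ?_⟩
  conv_lhs => rw [← Nat.div_add_mod k n, pow_add, pow_mul, hY, smul_pow]
  rw [smul_mul_assoc]

lemma aux_K {p : ℕ} [hp : Fact p.Prime] {ι : Type*} [Fintype ι] [DecidableEq ι]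
    (hc : Fintype.card ι < p) (U : Matrix ι ι ℤ_[p]) (m : ℕ)
    (h : ∃ Y : Matrix ι ι ℤ_[p], U ^ (p ^ m) - 1 = (p : ℤ_[p]) • Y) (k : ℕ) (hk : k ≠ 0) :
    ∃ Y : Matrix ι ι ℤ_[p], (U - 1) ^ k = (k : ℤ_[p]) • Y := by
  rcases isEmpty_or_nonempty ι with hi | hi
  · exact ⟨0, Subsingleton.elim _ _⟩
  obtain ⟨Y, hY⟩ := aux_pow (U - 1) _ (aux_card _ _ (aux_nilp U m h)) k
  obtain ⟨c, hc⟩ := aux_val (p := p) (d := Fintype.card ι) Fintype.card_pos hc hk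
  exact ⟨c • Y, by rw [hY, hc, mul_smul]⟩

lemma aux_E {p : ℕ} [hp : Fact p.Prime] {ι : Type*} [Fintype ι] [DecidableEq ι]
    (hc : Fintype.card ι < p) (U : Matrix ι ι ℤ_[p]) (m : ℕ)
    (h : ∃ Y : Matrix ι ι ℤ_[p], U ^ (p ^ m) - 1 = (p : ℤ_[p]) • Y) (n : ℕ) :
    ∃ Y : Matrix ι ι ℤ_[p], U ^ (p ^ n) - 1 = (p : ℤ_[p]) ^ n • Y := by
  have hK : ∀ k : ℕ, ∃ Y : Matrix ι ι ℤ_[p], (U - 1) ^ (k + 1) = ((k + 1 : ℕ) : ℤ_[p]) • Y :=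
    fun k => aux_K hc U m h _ (by omega)
  choose Y hY using hK
  refine ⟨∑ k ∈ Finset.range (p ^ n), ((p ^ n - 1).choose k : ℤ_[p]) • Y k, ?_⟩
  have : U ^ (p ^ n) = ((U - 1) + 1) ^ (p ^ n) := by simp
  rw [this, (Commute.one_right (U - 1)).add_pow, Finset.sum_range_succ', Finset.smul_sum]
  simp only [one_pow, mul_one, pow_zero, Nat.choose_zero_right, Nat.cast_one, add_sub_cancel_right]
  refine Finset.sum_congr rfl fun k hk => ?_
  rw [hY, smul_smul, smul_mul_assoc, ← nsmul_eq_mul', ← Nat.cast_smul_eq_nsmul ℤ_[p], smul_smul]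
  congr 1
  have hpos : 0 < p ^ n := pow_pos hp.out.pos _
  have := Nat.add_one_mul_choose_eq (p ^ n - 1) k
  rw [Nat.sub_add_cancel hpos] at this
  have h2 := congrArg (Nat.cast : ℕ → ℤ_[p]) this
  push_cast at h2 ⊢
  rw [h2]; ring

lemma aux_mod {p : ℕ} [hp : Fact p.Prime] {V : Type*} [AddCommGroup V] [Module ℤ_[p] V]
    [Module.Free ℤ_[p] V] [Module.Finite ℤ_[p] V] (hr : Module.finrank ℤ_[p] V < p)
    (T : V →ₗ[ℤ_[p]] V) (m : ℕ) (h : ∀ y, ∃ z, (T ^ (p ^ m)) y - y = (p : ℤ_[p]) • z) (n : ℕ)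
    (y : V) : ∃ z, (T ^ (p ^ n)) y - y = (p : ℤ_[p]) ^ n • z := by
  let b := Module.finBasis ℤ_[p] V
  let e := LinearMap.toMatrixAlgEquiv b
  choose z hz using h
  obtain ⟨Y, hY⟩ := aux_E (by simpa using hr) (e T) m
    ⟨Matrix.of fun i j => b.repr (z (b j)) i, by
      rw [← map_pow, ← map_one e, ← map_sub]
      ext i j
      simp only [e, LinearMap.toMatrixAlgEquiv_apply]
      simp [hz]⟩ n
  refine ⟨e.symm Y y, ?_⟩
  have : T ^ (p ^ n) - 1 = (p : ℤ_[p]) ^ n • e.symm Y := by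
    apply e.injective
    simpa using hY
  simpa using congrArg (fun f => f y) this

lemma aux_choose_ratio {p : ℕ} [hp : Fact p.Prime] (n j : ℕ) :
    ((p ^ n).choose (j + 1) : ℚ_[p]) =
      (p : ℚ_[p]) ^ n * ((p ^ n - 1).choose j * ((j + 1 : ℕ) : ℚ_[p])⁻¹) := by
  have hpos : 0 < p ^ n := pow_pos hp.out.pos _
  have := Nat.add_one_mul_choose_eq (p ^ n - 1) j
  rw [Nat.sub_add_cancel hpos] at this
  have h2 := congrArg (Nat.cast : ℕ → ℚ_[p]) this
  have h3 : ((j + 1 : ℕ) : ℚ_[p]) ≠ 0 := by exact_mod_cast Nat.succ_ne_zero j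
  push_cast at h2 h3 ⊢
  field_simp
  rw [h2]

lemma aux_p_tendsto (p : ℕ) [hp : Fact p.Prime] :
    Tendsto (fun n : ℕ => (p : ℚ_[p]) ^ n) atTop (𝓝 0) :=
  tendsto_pow_atTop_nhds_zero_of_norm_lt_one Padic.norm_p_lt_one

lemma aux_choose {p : ℕ} [hp : Fact p.Prime] (j : ℕ) :
    Tendsto (fun n : ℕ => ((p ^ n - 1).choose j : ℚ_[p])) atTop (𝓝 ((-1) ^ j)) := by
  induction j with
  | zero => simp
  | succ j ih =>
    have h : ∀ n : ℕ, ((p ^ n - 1).choose (j + 1) : ℚ_[p]) =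
        (p : ℚ_[p]) ^ n * ((p ^ n - 1).choose j * ((j + 1 : ℕ) : ℚ_[p])⁻¹)
          - (p ^ n - 1).choose j := fun n => by
      rw [← aux_choose_ratio]
      have hpos : 0 < p ^ n := pow_pos hp.out.pos _
      obtain ⟨q, hq⟩ : ∃ q, p ^ n = q + 1 := ⟨p ^ n - 1, by omega⟩
      rw [hq, Nat.choose_succ_succ]
      simp
    simp only [h]
    have := ((aux_p_tendsto p).mul (ih.mul_const (((j + 1 : ℕ) : ℚ_[p])⁻¹))).sub ih
    simpa [pow_succ] using this

lemma aux_summable {p : ℕ} [hp : Fact p.Prime] (M : ℕ) (hM : 0 < M) :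
    Summable (fun k : ℕ => (k : ℝ) * ((p : ℝ)⁻¹) ^ (k / M)) := by
  have hp1 : (1 : ℝ) < p := by exact_mod_cast hp.out.one_lt
  set s : ℝ := (p : ℝ)⁻¹
  have hs0 : 0 < s := by positivity
  have hs1 : s < 1 := inv_lt_one_of_one_lt₀ hp1
  set r : ℝ := s ^ ((M : ℝ)⁻¹) with hr
  have hrM : r ^ M = s := Real.rpow_inv_natCast_pow hs0.le hM.ne'
  have hr0 : 0 < r := Real.rpow_pos_of_pos hs0 _
  have hr1 : r < 1 := Real.rpow_lt_one hs0.le hs1 (by positivity)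
  have h := summable_pow_mul_geometric_of_norm_lt_one 1 (r := r) (by
    rw [Real.norm_of_nonneg hr0.le]; exact hr1)
  refine Summable.of_nonneg_of_le (fun k => by positivity) (fun k => ?_) (h.mul_left s⁻¹)
  rw [pow_one, mul_left_comm]
  refine mul_le_mul_of_nonneg_left ?_ (by positivity)
  rw [le_inv_mul_iff₀ hs0]
  have e : r ^ k = s ^ (k / M) * r ^ (k % M) := by
    conv_lhs => rw [← Nat.div_add_mod k M, pow_add, pow_mul, hrM]
  rw [e, mul_comm]
  refine mul_le_mul_of_nonneg_left ?_ (by positivity)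
  rw [← hrM]
  exact pow_le_pow_of_le_one hr0.le hr1.le (Nat.mod_lt _ hM).le

lemma aux_norm_inv {p : ℕ} [hp : Fact p.Prime] (k : ℕ) : ‖((k : ℚ_[p]))⁻¹‖ ≤ k := by
  rcases Nat.eq_zero_or_pos k with h | h
  · simp [h]
  obtain ⟨v, m, hm, rfl⟩ := Nat.exists_eq_pow_mul_and_not_dvd h.ne' p hp.out.ne_one
  have : ‖(m : ℚ_[p])‖ = 1 := by
    rw [Padic.norm_natCast_eq_one_iff]
    exact (Nat.Prime.coprime_iff_not_dvd hp.out).2 hm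
  push_cast
  rw [norm_inv, norm_mul, this, norm_pow, Padic.norm_p, mul_one, inv_pow, inv_inv]
  have hm1 : (1 : ℝ) ≤ m := by
    rcases Nat.eq_zero_or_pos m with h | h
    · simp [h] at hm
    · exact_mod_cast h
  exact le_mul_of_one_le_right (by positivity) hm1

lemma matQ_eq {p : ℕ} [Fact p.Prime] {N : ℕ} (x : Matrix (Fin N) (Fin N) ℤ_[p]) :
    matQ x = (PadicInt.Coe.ringHom (p := p)).mapMatrix x := rfl

lemma aux_tannery {p : ℕ} [Fact p.Prime] {G : Type*} [NormedAddCommGroup G] [NormedSpace ℚ_[p] G]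
    [FiniteDimensional ℚ_[p] G] {f : ℕ → ℕ → G} {g : ℕ → G} {bound : ℕ → ℝ}
    (h_sum : Summable bound) (hab : ∀ k, Tendsto (f · k) atTop (𝓝 (g k)))
    (h_bound : ∀ᶠ n in atTop, ∀ k, ‖f n k‖ ≤ bound k) :
    Tendsto (∑' k, f · k) atTop (𝓝 (∑' k, g k)) := by
  have : CompleteSpace G := FiniteDimensional.complete ℚ_[p] G
  exact tendsto_tsum_of_dominated_convergence h_sum hab h_bound

section norms
attribute [local instance] Matrix.normedAddCommGroup Matrix.normedSpace

lemma aux_log {p : ℕ} [hp : Fact p.Prime] {N : ℕ} (u : Matrix (Fin N) (Fin N) ℤ_[p]) (m : ℕ)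
    (h : ∃ Y : Matrix (Fin N) (Fin N) ℤ_[p], u ^ (p ^ m) - 1 = (p : ℤ_[p]) • Y) :
    Tendsto (fun n : ℕ => ((p : ℚ_[p]) ^ n)⁻¹ • ((matQ u) ^ (p ^ n) - 1)) atTop
      (𝓝 (matLog (matQ u))) := by
  have hM : 0 < p ^ m := pow_pos hp.out.pos _
  have hb : ∀ k : ℕ, ‖(matQ u - 1) ^ k‖ ≤ ((p : ℝ)⁻¹) ^ (k / p ^ m) := by
    intro k
    obtain ⟨Y, hY⟩ := aux_pow (u - 1) _ (aux_nilp u m h) k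
    have : (matQ u - 1) ^ k = (p : ℚ_[p]) ^ (k / p ^ m) • matQ Y := by
      have := congrArg (fun x => (PadicInt.Coe.ringHom (p := p)).mapMatrix x) hY
      simp only [map_pow, map_sub, map_one, ← matQ_eq] at this
      rw [this]
      ext i j
      simp [matQ]
    rw [this, norm_smul, norm_pow, Padic.norm_p]
    refine mul_le_of_le_one_right (by positivity) ?_
    rw [Matrix.norm_le_iff zero_le_one]
    intro i j
    exact PadicInt.norm_le_one _
  let f : ℕ → ℕ → Matrix (Fin N) (Fin N) ℚ_[p] := fun n k =>
    (((p ^ n - 1).choose (k - 1) : ℚ_[p]) * ((k : ℚ_[p]))⁻¹) • (matQ u - 1) ^ k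
  have hf : ∀ n : ℕ, ((p : ℚ_[p]) ^ n)⁻¹ • ((matQ u) ^ (p ^ n) - 1) = ∑' k, f n k := by
    intro n
    have hpos : 0 < p ^ n := pow_pos hp.out.pos _
    have hp0 : (p : ℚ_[p]) ^ n ≠ 0 := pow_ne_zero _ (by exact_mod_cast hp.out.ne_zero)
    rw [tsum_eq_sum (s := Finset.range (p ^ n + 1))]
    · have : (matQ u) ^ (p ^ n) = ((matQ u - 1) + 1) ^ (p ^ n) := by simp
      rw [this, (Commute.one_right (matQ u - 1)).add_pow, Finset.sum_range_succ',
        Finset.sum_range_succ']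
      simp only [one_pow, mul_one, pow_zero, Nat.choose_zero_right, Nat.cast_one,
        add_sub_cancel_right]
      rw [Finset.smul_sum]
      have h0 : f n 0 = 0 := by simp [f]
      rw [h0, add_zero]
      refine Finset.sum_congr rfl fun k hk => ?_
      rw [← nsmul_eq_mul', ← Nat.cast_smul_eq_nsmul ℚ_[p], smul_smul, aux_choose_ratio,
        inv_mul_cancel_left₀ hp0]
      rfl
    · intro k hk
      simp only [Finset.mem_range, not_lt] at hk
      simp only [f]
      rw [Nat.choose_eq_zero_of_lt (by omega)]
      simp
  simp only [hf]
  have hlog : matLog (matQ u) = ∑' k : ℕ, -(((k : ℚ_[p]))⁻¹ • (1 - matQ u) ^ k) := by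
    rw [matLog, tsum_neg]
  rw [hlog]
  refine aux_tannery (p := p) (aux_summable (p := p) (p ^ m) hM) ?_ ?_
  · intro k
    rcases k with _ | k
    · simp [f]
    · have h1 := ((aux_choose (p := p) k).mul_const (((k + 1 : ℕ) : ℚ_[p])⁻¹)).smul_const
        ((matQ u - 1) ^ (k + 1))
      have h2 : -((((k + 1 : ℕ) : ℚ_[p]))⁻¹ • (1 - matQ u) ^ (k + 1)) =
          ((-1) ^ k * ((k + 1 : ℕ) : ℚ_[p])⁻¹) • (matQ u - 1) ^ (k + 1) := by
        rw [← neg_sub (matQ u) 1, neg_pow, pow_succ (-1 : Matrix (Fin N) (Fin N) ℚ_[p])]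
        rcases Nat.even_or_odd k with h' | h' <;> simp [h'.neg_one_pow]
      rw [h2]
      exact h1
  · refine Eventually.of_forall fun n k => ?_
    simp only [f]
    rw [norm_smul, norm_mul]
    refine mul_le_mul ?_ (hb k) (norm_nonneg _) (by positivity)
    calc _ ≤ 1 * (k : ℝ) := mul_le_mul (by exact_mod_cast Padic.norm_int_le_one (p := p) ((p ^ n - 1).choose (k - 1) : ℕ)) (aux_norm_inv k) (norm_nonneg _) zero_le_one
      _ = k := one_mul _

end norms

lemma matQ_emb {p : ℕ} [Fact p.Prime] {N : ℕ} :
    IsClosedEmbedding (matQ : Matrix (Fin N) (Fin N) ℤ_[p] → Matrix (Fin N) (Fin N) ℚ_[p]) := by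
  have : CompactSpace (Matrix (Fin N) (Fin N) ℤ_[p]) :=
    inferInstanceAs (CompactSpace (Fin N → Fin N → ℤ_[p]))
  refine Continuous.isClosedEmbedding ?_ ?_
  · exact Continuous.matrix_map continuous_id continuous_subtype_val
  · intro x y h
    ext i j
    exact Subtype.ext (congrFun (congrFun h i) j)

lemma resUnip_iff {p : ℕ} [Fact p.Prime] {N : ℕ} {u : Matrix (Fin N) (Fin N) ℤ_[p]}
    (h : ResUnip u) : ∃ m : ℕ, ∃ Y : Matrix (Fin N) (Fin N) ℤ_[p],
      u ^ (p ^ m) - 1 = (p : ℤ_[p]) • Y := by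
  obtain ⟨-, m, hm⟩ := h
  choose Y hY using hm
  exact ⟨m, Matrix.of Y, by ext i j; rw [hY]; simp⟩

lemma aux_lg {p : ℕ} [hp : Fact p.Prime] {N : ℕ} (hN : N < p)
    {u : Matrix (Fin N) (Fin N) ℤ_[p]} (hu : ResUnip u) :
    ∃ x : Matrix (Fin N) (Fin N) ℤ_[p], matQ x = matLog (matQ u) ∧
      ∃ E : ℕ → Matrix (Fin N) (Fin N) ℤ_[p],
        (∀ n, u ^ (p ^ n) - 1 = (p : ℤ_[p]) ^ n • E n) ∧ Tendsto E atTop (𝓝 x) := by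
  obtain ⟨m, h⟩ := resUnip_iff hu
  have hE := aux_E (by simpa using hN) u m h
  choose E hE using hE
  have hl := aux_log u m h
  have e : ∀ n : ℕ, ((p : ℚ_[p]) ^ n)⁻¹ • ((matQ u) ^ (p ^ n) - 1) = matQ (E n) := by
    intro n
    have hp0 : (p : ℚ_[p]) ^ n ≠ 0 := pow_ne_zero _ (by exact_mod_cast hp.out.ne_zero)
    have := congrArg (fun x => (PadicInt.Coe.ringHom (p := p)).mapMatrix x) (hE n)
    simp only [map_pow, map_sub, map_one, ← matQ_eq] at this
    rw [this, inv_smul_eq_iff₀ hp0]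
    ext i j
    simp [matQ]
  simp only [e] at hl
  have hmem : matLog (matQ u) ∈ Set.range (matQ : Matrix (Fin N) (Fin N) ℤ_[p] → _) :=
    matQ_emb.isClosed_range.mem_of_tendsto hl (Eventually.of_forall fun n => ⟨_, rfl⟩)
  obtain ⟨x, hx⟩ := hmem
  refine ⟨x, hx, E, hE, ?_⟩
  rw [matQ_emb.isInducing.tendsto_nhds_iff, hx]
  exact hl

lemma resUnip_conj {p : ℕ} [hp : Fact p.Prime] {N : ℕ} (g h : GL (Fin N) ℤ_[p])
    (hu : ResUnip (h : Matrix (Fin N) (Fin N) ℤ_[p])) :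
    ResUnip ((g * h * g⁻¹ : GL (Fin N) ℤ_[p]) : Matrix (Fin N) (Fin N) ℤ_[p]) := by
  obtain ⟨m, Y, hY⟩ := resUnip_iff hu
  refine ⟨Units.isUnit _, m, fun i j => ?_⟩
  have : ((g * h * g⁻¹ : GL (Fin N) ℤ_[p]) : Matrix (Fin N) (Fin N) ℤ_[p]) ^ (p ^ m) - 1
      = (p : ℤ_[p]) • ((g : Matrix (Fin N) (Fin N) ℤ_[p]) * Y *
        ((g⁻¹ : GL (Fin N) ℤ_[p]) : Matrix (Fin N) (Fin N) ℤ_[p])) := by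
    rw [← Units.val_pow_eq_pow_val, conj_pow]
    rw [← smul_mul_assoc, ← mul_smul_comm, ← hY, mul_sub, sub_mul]
    simp only [Units.val_mul, Units.val_pow_eq_pow_val, mul_one, Units.mul_inv]
  rw [this]
  simp

/-- the integral span -/
def KK {p : ℕ} [Fact p.Prime] {N : ℕ} (H : Subgroup (GL (Fin N) ℤ_[p])) :
    Set (Matrix (Fin N) (Fin N) ℤ_[p]) :=
  {x | ∃ h : GL (Fin N) ℤ_[p], h ∈ H ∧ ResUnip (h : Matrix (Fin N) (Fin N) ℤ_[p]) ∧
    matQ x = matLog (matQ (h : Matrix (Fin N) (Fin N) ℤ_[p]))}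

lemma KK_conj {p : ℕ} [hp : Fact p.Prime] {N : ℕ} (hN : N < p) (H : Subgroup (GL (Fin N) ℤ_[p]))
    (g : GL (Fin N) ℤ_[p]) (hg : g ∈ H) (x : Matrix (Fin N) (Fin N) ℤ_[p])
    (hx : x ∈ Submodule.span ℤ_[p] (KK H)) :
    (g : Matrix (Fin N) (Fin N) ℤ_[p]) * x *
        ((g⁻¹ : GL (Fin N) ℤ_[p]) : Matrix (Fin N) (Fin N) ℤ_[p]) ∈
      Submodule.span ℤ_[p] (KK H) := by
  induction hx using Submodule.span_induction with
  | zero => simp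
  | add x y _ _ hx hy => rw [mul_add, add_mul]; exact add_mem hx hy
  | smul a x _ hx => rw [mul_smul_comm, smul_mul_assoc]; exact Submodule.smul_mem _ _ hx
  | mem x hx =>
    obtain ⟨h, hh, hu, hx⟩ := hx
    apply Submodule.subset_span
    have hu' := resUnip_conj g h hu
    refine ⟨g * h * g⁻¹, H.mul_mem (H.mul_mem hg hh) (H.inv_mem hg), hu', ?_⟩
    obtain ⟨x', hx', E, hE, hl⟩ := aux_lg hN hu
    obtain ⟨y', hy', F, hF, hl'⟩ := aux_lg hN hu'
    have hxx : x = x' := matQ_emb.injective (hx.trans hx'.symm)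
    subst hxx
    rw [← hy']
    congr 1
    have hEF : ∀ n, (g : Matrix (Fin N) (Fin N) ℤ_[p]) * E n *
        ((g⁻¹ : GL (Fin N) ℤ_[p]) : Matrix (Fin N) (Fin N) ℤ_[p]) = F n := by
      intro n
      have hp0 : (p : ℤ_[p]) ^ n ≠ 0 := pow_ne_zero _ (by exact_mod_cast hp.out.ne_zero)
      apply smul_right_injective _ hp0
      simp only
      rw [← hF, ← smul_mul_assoc, ← mul_smul_comm, ← hE, ← Units.val_pow_eq_pow_val (g * h * g⁻¹) (p ^ n),
        conj_pow, mul_sub, sub_mul]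
      simp only [Units.val_mul, Units.val_pow_eq_pow_val, mul_one, Units.mul_inv]
    refine tendsto_nhds_unique (((continuous_const.mul continuous_id).mul
      continuous_const).tendsto x |>.comp hl) ?_
    refine hl'.congr fun n => ?_
    rw [← hEF]; rfl

open scoped Pointwise in
lemma aux_AR {p : ℕ} [hp : Fact p.Prime] {M : Type*} [AddCommGroup M] [Module ℤ_[p] M]
    [Module.Finite ℤ_[p] M] (K : Submodule ℤ_[p] M) :
    ∃ c : ℕ, ∀ y ∈ K, (∃ z : M, y = (p : ℤ_[p]) ^ c • z) → ∃ z ∈ K, y = (p : ℤ_[p]) • z := by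
  obtain ⟨k, hk⟩ := Ideal.exists_pow_inf_eq_pow_smul (Ideal.span {(p : ℤ_[p])}) K
  refine ⟨k + 1, ?_⟩
  rintro y hy ⟨z, rfl⟩
  have h := hk (k + 1) (by omega)
  have hm : (p : ℤ_[p]) ^ (k + 1) • z ∈
      (Ideal.span {(p : ℤ_[p])} ^ (k + 1) • (⊤ : Submodule ℤ_[p] M) ⊓ K) := by
    refine ⟨?_, hy⟩
    rw [Ideal.span_singleton_pow]
    exact Submodule.smul_mem_smul (Ideal.mem_span_singleton_self _) trivial
  rw [h] at hm
  have h1 : k + 1 - k = 1 := by omega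
  rw [h1, pow_one] at hm
  rw [Submodule.ideal_span_singleton_smul, Submodule.mem_smul_pointwise_iff_exists] at hm
  obtain ⟨w, hw, hw'⟩ := hm
  exact ⟨w, hw.2, hw'.symm⟩

lemma KK_bracket {p : ℕ} [hp : Fact p.Prime] {N : ℕ} (hN : N < p) (hN2 : N ^ 2 < p)
    (H : Subgroup (GL (Fin N) ℤ_[p])) (x y : Matrix (Fin N) (Fin N) ℤ_[p])
    (hx : x ∈ KK H) (hy : y ∈ Submodule.span ℤ_[p] (KK H)) :
    x * y - y * x ∈ Submodule.span ℤ_[p] (KK H) := by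
  obtain ⟨u, hu, hr, hx⟩ := hx
  obtain ⟨x', hx', E, hE, hl⟩ := aux_lg hN hr
  have hxx : x = x' := matQ_emb.injective (hx.trans hx'.symm)
  subst hxx
  set K := Submodule.span ℤ_[p] (KK H) with hK
  let U : Matrix (Fin N) (Fin N) ℤ_[p] := u
  let V : Matrix (Fin N) (Fin N) ℤ_[p] := (u⁻¹ : GL (Fin N) ℤ_[p])
  have hUV : U * V = 1 := Units.mul_inv u
  have hVU : V * U = 1 := Units.inv_mul u
  have hUVn : ∀ n, U ^ n * V ^ n = 1 := fun n => by
    rw [← (show Commute U V from hUV.trans hVU.symm).mul_pow, hUV, one_pow]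
  let T0 : Matrix (Fin N) (Fin N) ℤ_[p] →ₗ[ℤ_[p]] Matrix (Fin N) (Fin N) ℤ_[p] :=
    (LinearMap.mulLeft ℤ_[p] U).comp (LinearMap.mulRight ℤ_[p] V)
  have hT0 : ∀ z, T0 z = U * (z * V) := fun z => rfl
  let T : K →ₗ[ℤ_[p]] K := T0.restrict fun z hz => by
    rw [hT0, ← mul_assoc]; exact KK_conj hN H u hu z hz
  have hTn : ∀ (n : ℕ) (z : K), (((T ^ n) z : K) : Matrix (Fin N) (Fin N) ℤ_[p])
      = U ^ n * z * V ^ n := by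
    intro n
    induction n with
    | zero => intro z; simp
    | succ n ih =>
      intro z
      rw [pow_succ, Module.End.mul_apply, ih]
      have : ((T z : K) : Matrix (Fin N) (Fin N) ℤ_[p]) = U * (z * V) := rfl
      rw [this, pow_succ U, pow_succ' V]
      simp only [mul_assoc]
  have key : ∀ (n : ℕ) (z : Matrix (Fin N) (Fin N) ℤ_[p]), U ^ (p ^ n) * z * V ^ (p ^ n) - z =
      (p : ℤ_[p]) ^ n • ((E n * z - z * E n) * V ^ (p ^ n)) := by
    intro n z
    rw [← smul_mul_assoc, smul_sub, ← smul_mul_assoc, ← mul_smul_comm, ← hE]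
    simp only [sub_mul, mul_sub, one_mul, mul_one, mul_assoc]
    have := hUVn (p ^ n)
    simp only [U] at this ⊢
    rw [this]
    simp
  obtain ⟨c, hc⟩ := aux_AR K
  have hfr : Module.finrank ℤ_[p] K < p := by
    refine (Submodule.finrank_le K).trans_lt ?_
    rw [Module.finrank_matrix]
    simpa [sq] using hN2
  have hz : ∀ n, ∃ z : K, (T ^ (p ^ n)) ⟨y, hy⟩ - ⟨y, hy⟩ = (p : ℤ_[p]) ^ n • z := by
    intro n
    refine aux_mod hfr T c ?_ n ⟨y, hy⟩
    intro w
    obtain ⟨z, hz, hz'⟩ := hc _ ((T ^ (p ^ c)) w - w).2 ⟨_, by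
      push_cast
      rw [hTn, key]⟩
    exact ⟨⟨z, hz⟩, Subtype.ext hz'⟩
  choose z hz using hz
  have hz' : ∀ n, (z n : Matrix (Fin N) (Fin N) ℤ_[p]) = (E n * y - y * E n) * V ^ (p ^ n) := by
    intro n
    have hp0 : (p : ℤ_[p]) ^ n ≠ 0 := pow_ne_zero _ (by exact_mod_cast hp.out.ne_zero)
    apply smul_right_injective _ hp0
    simp only
    rw [← key]
    have := congrArg (Subtype.val) (hz n)
    push_cast at this
    rw [hTn] at this
    exact this.symm
  have hclosed : IsClosed (K : Set (Matrix (Fin N) (Fin N) ℤ_[p])) :=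
    (Submodule.isCompact_of_fg (IsNoetherian.noetherian K)).isClosed
  have hpt : Tendsto (fun n : ℕ => (p : ℤ_[p]) ^ n) atTop (𝓝 0) :=
    tendsto_pow_atTop_nhds_zero_of_norm_lt_one (by
      rw [PadicInt.norm_p]
      exact inv_lt_one_of_one_lt₀ (by exact_mod_cast hp.out.one_lt))
  have hVr : ResUnip V := by
    obtain ⟨m, Y, hY⟩ := resUnip_iff hr
    refine ⟨Units.isUnit u⁻¹, m, fun i j => ?_⟩
    have : V ^ (p ^ m) - 1 = (p : ℤ_[p]) • (-(Y * V ^ (p ^ m))) := by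
      rw [smul_neg, ← smul_mul_assoc, ← hY, sub_mul]
      have := hUVn (p ^ m)
      simp only [U] at this
      rw [this]
      simp
    rw [this]
    simp
  obtain ⟨v, -, F, hF, hFl⟩ := aux_lg hN hVr
  have hVt : Tendsto (fun n => V ^ (p ^ n)) atTop (𝓝 1) := by
    have : Tendsto (fun n => (p : ℤ_[p]) ^ n • F n + 1) atTop (𝓝 ((0 : ℤ_[p]) • v + 1)) :=
      (hpt.smul hFl).add_const 1
    rw [zero_smul, zero_add] at this
    refine this.congr fun n => ?_
    rw [← hF]; simp
  have hfin : Tendsto (fun n => (z n : Matrix (Fin N) (Fin N) ℤ_[p])) atTop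
      (𝓝 ((x * y - y * x) * 1)) := by
    simp only [hz']
    exact ((hl.mul_const y).sub (hl.const_mul y)).mul hVt
  rw [mul_one] at hfin
  exact hclosed.mem_of_tendsto hfin (Eventually.of_forall fun n => (z n).2)

/-- **Proposition (the module generated by logarithms is a Lie algebra).**
Let `N ≥ 1`, `p > 2N` and `p > N² + 1`, and let `H` be a subgroup of `GL(N, ℤ_[p])`.
Then the `ℤ_[p]`-submodule of `gl(N, ℤ_[p])` generated by
`{ log h : h ∈ H residually unipotent }` is closed under the Lie bracket
`[x, y] = x y - y x`. -/
theorem stmt_12 (N : ℕ) (hN : 1 ≤ N) (p : ℕ) [Fact p.Prime]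
    (hp : 2 * N < p) (hp' : N ^ 2 + 1 < p)
    (H : Subgroup (GL (Fin N) ℤ_[p])) :
    ∀ a ∈ Submodule.span ℤ_[p]
        {z : Matrix (Fin N) (Fin N) ℚ_[p] |
          ∃ h : GL (Fin N) ℤ_[p], h ∈ H ∧ ResUnip (h : Matrix (Fin N) (Fin N) ℤ_[p]) ∧
            z = matLog (matQ (h : Matrix (Fin N) (Fin N) ℤ_[p]))},
      ∀ b ∈ Submodule.span ℤ_[p]
        {z : Matrix (Fin N) (Fin N) ℚ_[p] |
          ∃ h : GL (Fin N) ℤ_[p], h ∈ H ∧ ResUnip (h : Matrix (Fin N) (Fin N) ℤ_[p]) ∧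
            z = matLog (matQ (h : Matrix (Fin N) (Fin N) ℤ_[p]))},
      a * b - b * a ∈ Submodule.span ℤ_[p]
        {z : Matrix (Fin N) (Fin N) ℚ_[p] |
          ∃ h : GL (Fin N) ℤ_[p], h ∈ H ∧ ResUnip (h : Matrix (Fin N) (Fin N) ℤ_[p]) ∧
            z = matLog (matQ (h : Matrix (Fin N) (Fin N) ℤ_[p]))} := by
  set S : Set (Matrix (Fin N) (Fin N) ℚ_[p]) := {z : Matrix (Fin N) (Fin N) ℚ_[p] |
          ∃ h : GL (Fin N) ℤ_[p], h ∈ H ∧ ResUnip (h : Matrix (Fin N) (Fin N) ℤ_[p]) ∧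
            z = matLog (matQ (h : Matrix (Fin N) (Fin N) ℤ_[p]))} with hS
  have hN1 : N < p := by omega
  have hN2 : N ^ 2 < p := by omega
  let f : Matrix (Fin N) (Fin N) ℤ_[p] →ₗ[ℤ_[p]] Matrix (Fin N) (Fin N) ℚ_[p] :=
    { toFun := matQ
      map_add' := fun x y => by ext i j; simp [matQ]
      map_smul' := fun c x => by ext i j; simp [matQ]; rfl }
  have hSK : S = f '' KK H := by
    ext z
    constructor
    · rintro ⟨h, hh, hr, rfl⟩
      obtain ⟨x, hx, -⟩ := aux_lg hN1 hr
      exact ⟨x, ⟨h, hh, hr, hx⟩, hx⟩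
    · rintro ⟨x, ⟨h, hh, hr, hx⟩, rfl⟩
      exact ⟨h, hh, hr, hx⟩
  rw [hSK, Submodule.span_image]
  rintro _ ⟨a, ha, rfl⟩ _ ⟨b, hb, rfl⟩
  have hab : a * b - b * a ∈ Submodule.span ℤ_[p] (KK H) := by
    induction ha using Submodule.span_induction with
    | zero => simp
    | add x y _ _ hx hy =>
      have := add_mem hx hy
      convert this using 1
      noncomm_ring
    | smul c x _ hx =>
      have := Submodule.smul_mem _ c hx
      rwa [smul_sub, ← smul_mul_assoc, ← mul_smul_comm] at this
    | mem x hx => exact KK_bracket hN1 hN2 H x b hx hb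
  refine ⟨a * b - b * a, hab, ?_⟩
  change (PadicInt.Coe.ringHom (p := p)).mapMatrix (a * b - b * a) =
    (PadicInt.Coe.ringHom (p := p)).mapMatrix a * (PadicInt.Coe.ringHom (p := p)).mapMatrix b -
    (PadicInt.Coe.ringHom (p := p)).mapMatrix b * (PadicInt.Coe.ringHom (p := p)).mapMatrix a
  rw [map_sub, map_mul, map_mul]
end

section
/- Let r ≥ 1 be an integer and let B be a commutative ring equipped with a surjective ring homomorphism π : ℤ[Y₁, …, Y_r] → B. Assume that B is flat (equivalently, torsion-free) as a ℤ-module, that B ⊗_ℤ ℚ̄ is an integral domain, where ℚ̄ is an algebraic closure of ℚ, and that the Krull dimension s of B ⊗_ℤ ℚ satisfies s ≥ 1. Then there exists a constant C > 0 (depending on B and π) with the following property: for every prime p, every integer d ≥ 1 and every nonzero element f of B ⊗_ℤ 𝔽_p which is the image, under the base change of π to 𝔽_p, of a polynomial in 𝔽_p[Y₁, …, Y_r] of total degree ≤ d, the number of 𝔽_p-algebra homomorphisms φ : B ⊗_ℤ 𝔽_p → 𝔽_p with φ(f) = 0 is at most C · d · p^(s−1). -/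
open scoped TensorProduct

theorem aux_nullst {ι : Type*} [Finite ι] (J : Ideal (MvPolynomial ι ℤ))
    (h : ∀ x : ι → AlgebraicClosure ℚ, ∃ q ∈ J, MvPolynomial.aeval x q ≠ 0) :
    ∃ N : ℤ, N ≠ 0 ∧ MvPolynomial.C N ∈ J := by
  let := MvPolynomial.algebraMvPolynomial (σ := ι) (R := ℤ) (S := ℚ)
  let I : Ideal (MvPolynomial ι ℚ) := J.map (algebraMap (MvPolynomial ι ℤ) (MvPolynomial ι ℚ))
  have hz : MvPolynomial.zeroLocus (AlgebraicClosure ℚ) I = ∅ := by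
    rw [Set.eq_empty_iff_forall_notMem]
    intro x hx
    obtain ⟨q, hq, hne⟩ := h x
    apply hne
    have := hx _ (Ideal.mem_map_of_mem _ hq)
    rwa [MvPolynomial.algebraMap_def, MvPolynomial.aeval_map_algebraMap] at this
  have h1 := MvPolynomial.vanishingIdeal_zeroLocus_eq_radical (K := AlgebraicClosure ℚ) I
  rw [hz] at h1
  have h2 : (1 : MvPolynomial ι ℚ) ∈ I := by
    rw [← Ideal.eq_top_iff_one, ← Ideal.radical_eq_top, ← h1]
    rw [Ideal.eq_top_iff_one]
    intro x hx
    exact hx.elim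
  rw [IsLocalization.mem_map_algebraMap_iff ((nonZeroDivisors ℤ).map (MvPolynomial.C (σ := ι)))] at h2
  obtain ⟨⟨⟨u, hu⟩, ⟨v, hv⟩⟩, huv⟩ := h2
  obtain ⟨N, hN, rfl⟩ := hv
  refine ⟨N, nonZeroDivisors.ne_zero hN, ?_⟩
  simp only [one_mul] at huv
  have : MvPolynomial.C N = u := by
    apply MvPolynomial.map_injective (algebraMap ℤ ℚ) (RingHom.injective_int _)
    rw [MvPolynomial.algebraMap_def] at huv
    exact huv
  rwa [this]

theorem aux_irr {σ k : Type*} [Field k] (F : MvPolynomial σ k) (hD : 1 ≤ F.totalDegree)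
    (h : ∀ G H : MvPolynomial σ k, G.totalDegree < F.totalDegree → H.totalDegree < F.totalDegree →
      F ≠ G * H) : Irreducible F := by
  have hF0 : F ≠ 0 := by rintro rfl; simp at hD
  have key : ∀ G : MvPolynomial σ k, G ≠ 0 → G.totalDegree = 0 → IsUnit G := by
    intro G hG h0
    rw [MvPolynomial.totalDegree_eq_zero_iff_eq_C] at h0
    rw [h0]
    apply IsUnit.map
    rw [isUnit_iff_ne_zero]
    intro h1
    rw [h1] at h0
    exact hG (by simpa using h0)
  constructor
  · intro hu
    obtain ⟨G, hG⟩ := hu.exists_right_inv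
    have hG0 : G ≠ 0 := by rintro rfl; simp at hG
    have := MvPolynomial.totalDegree_mul_of_isDomain hF0 hG0
    rw [hG] at this
    simp at this
    omega
  · intro G H hGH
    have hG0 : G ≠ 0 := by rintro rfl; simp at hGH; exact hF0 hGH
    have hH0 : H ≠ 0 := by rintro rfl; simp at hGH; exact hF0 hGH
    have := MvPolynomial.totalDegree_mul_of_isDomain hG0 hH0
    rw [← hGH] at this
    by_cases h1 : G.totalDegree = 0
    · exact Or.inl (key G hG0 h1)
    by_cases h2 : H.totalDegree = 0
    · exact Or.inr (key H hH0 h2)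
    exact absurd hGH (h G H (by omega) (by omega))

theorem aux_exists_top {σ R : Type*} [CommRing R] (F : MvPolynomial σ R) (hF : F ≠ 0) :
    ∃ e : σ →₀ ℕ, F.coeff e ≠ 0 ∧ e.degree = F.totalDegree := by
  have hne : F.support.Nonempty := MvPolynomial.support_nonempty.2 hF
  obtain ⟨e, he, heq⟩ := Finset.exists_mem_eq_sup F.support hne (fun s => s.sum fun _ e => e)
  exact ⟨e, MvPolynomial.mem_support_iff.1 he, heq.symm⟩

theorem aux_deg_map {σ R k : Type*} [CommRing R] [CommRing k] (φ : R →+* k) (F : MvPolynomial σ R)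
    (e : σ →₀ ℕ) (he : e.degree = F.totalDegree) (h : φ (F.coeff e) ≠ 0) :
    (MvPolynomial.map φ F).totalDegree = F.totalDegree := by
  apply le_antisymm
  · exact Finset.sup_mono (MvPolynomial.support_map_subset _ _)
  · rw [← he]
    have h1 : e ∈ (MvPolynomial.map φ F).support := by
      rw [MvPolynomial.mem_support_iff, MvPolynomial.coeff_map]
      exact h
    exact MvPolynomial.le_totalDegree h1

/-- generic polynomial with given coefficients -/
noncomputable def auxGen {σ : Type*} (n : ℕ) [Fintype {e : σ →₀ ℕ // e.degree ≤ n}]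
    {R : Type*} [CommRing R] (a : {e : σ →₀ ℕ // e.degree ≤ n} → R) : MvPolynomial σ R :=
  ∑ e, MvPolynomial.monomial e.1 (a e)

theorem auxGen_map {σ : Type*} (n : ℕ) [Fintype {e : σ →₀ ℕ // e.degree ≤ n}]
    {R S : Type*} [CommRing R] [CommRing S] (φ : R →+* S) (a : {e : σ →₀ ℕ // e.degree ≤ n} → R) :
    MvPolynomial.map φ (auxGen n a) = auxGen n (fun e => φ (a e)) := by
  simp [auxGen, MvPolynomial.map_monomial]

theorem auxGen_deg {σ : Type*} (n : ℕ) [Fintype {e : σ →₀ ℕ // e.degree ≤ n}]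
    {R : Type*} [CommRing R] (a : {e : σ →₀ ℕ // e.degree ≤ n} → R) :
    (auxGen n a).totalDegree ≤ n := by
  apply MvPolynomial.totalDegree_finsetSum_le
  intro e _
  exact (MvPolynomial.totalDegree_monomial_le _ _).trans e.2

theorem auxGen_coeff {σ : Type*} (n : ℕ) [Fintype {e : σ →₀ ℕ // e.degree ≤ n}]
    {R : Type*} [CommRing R] (G : MvPolynomial σ R) (hG : G.totalDegree ≤ n) :
    auxGen n (fun e => G.coeff e.1) = G := by
  classical
  ext d
  simp only [auxGen, MvPolynomial.coeff_sum, MvPolynomial.coeff_monomial]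
  by_cases hd : d.degree ≤ n
  · rw [Finset.sum_eq_single ⟨d, hd⟩]
    · simp
    · intro b _ hb
      rw [if_neg]
      intro h
      exact hb (Subtype.ext h)
    · simp
  · rw [Finset.sum_eq_zero]
    · symm
      apply MvPolynomial.coeff_eq_zero_of_totalDegree_lt
      change _ < d.degree
      omega
    · intro b _
      rw [if_neg]
      rintro rfl
      exact hd b.2

theorem aux_irr_mod {σ : Type*} [Finite σ] (F : MvPolynomial σ ℤ)
    (hF : Irreducible (MvPolynomial.map (algebraMap ℤ (AlgebraicClosure ℚ)) F)) :
    ∃ N : ℤ, N ≠ 0 ∧ ∀ p : ℕ, [Fact p.Prime] → ¬ (p : ℤ) ∣ N →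
      Irreducible (MvPolynomial.map (Int.castRingHom (ZMod p)) F) := by
  classical
  have hinj : Function.Injective (algebraMap ℤ (AlgebraicClosure ℚ)) := RingHom.injective_int _
  have hF0 : F ≠ 0 := by
    rintro rfl
    simp at hF
  obtain ⟨e, he0, he⟩ := aux_exists_top F hF0
  have hdeg := aux_deg_map (algebraMap ℤ (AlgebraicClosure ℚ)) F e he
    (by rwa [Ne, map_eq_zero_iff _ hinj])
  have unit_deg : ∀ G : MvPolynomial σ (AlgebraicClosure ℚ), IsUnit G → G.totalDegree = 0 := by
    intro G hG
    obtain ⟨H, hH⟩ := hG.exists_right_inv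
    have hG0 : G ≠ 0 := by rintro rfl; simp at hH
    have hH0 : H ≠ 0 := by rintro rfl; simp at hH
    have := MvPolynomial.totalDegree_mul_of_isDomain hG0 hH0
    rw [hH] at this
    simp at this
    omega
  have hD : 1 ≤ F.totalDegree := by
    by_contra hlt
    apply hF.not_isUnit
    have h0 : (MvPolynomial.map (algebraMap ℤ (AlgebraicClosure ℚ)) F).totalDegree = 0 := by omega
    have hne := hF.ne_zero
    rw [MvPolynomial.totalDegree_eq_zero_iff_eq_C] at h0
    rw [h0] at hne ⊢
    apply IsUnit.map
    rw [isUnit_iff_ne_zero]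
    intro h1
    rw [h1] at hne
    simp at hne
  set n := F.totalDegree - 1 with hn
  have : Finite {e : σ →₀ ℕ // e.degree ≤ n} := Finsupp.finite_of_degree_le n
  have : Fintype {e : σ →₀ ℕ // e.degree ≤ n} := Fintype.ofFinite _
  set I := {e : σ →₀ ℕ // e.degree ≤ n} with hI
  let E : MvPolynomial σ (MvPolynomial (I ⊕ I) ℤ) :=
    auxGen n (fun e => MvPolynomial.X (Sum.inl e)) * auxGen n (fun e => MvPolynomial.X (Sum.inr e))
      - MvPolynomial.map MvPolynomial.C F
  let J : Ideal (MvPolynomial (I ⊕ I) ℤ) := Ideal.span (Set.range fun d => E.coeff d)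
  have hE : ∀ (k : Type) [CommRing k] (x : I ⊕ I → k),
      MvPolynomial.map (MvPolynomial.eval₂Hom (Int.castRingHom k) x) E =
      auxGen n (fun e => x (Sum.inl e)) * auxGen n (fun e => x (Sum.inr e))
      - MvPolynomial.map (Int.castRingHom k) F := by
    intro k _ x
    simp only [E, map_sub, map_mul, auxGen_map, MvPolynomial.map_map]
    simp only [MvPolynomial.eval₂Hom_X']
    congr 2
    apply congrArg
    ext
    simp
  obtain ⟨N, hN0, hNJ⟩ := aux_nullst J (by
    intro x
    by_contra hcon
    push Not at hcon
    have h0 : MvPolynomial.map (MvPolynomial.eval₂Hom (Int.castRingHom _) x) E = 0 := by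
      ext d
      rw [MvPolynomial.coeff_map]
      exact hcon _ (Ideal.subset_span ⟨d, rfl⟩)
    rw [hE, sub_eq_zero] at h0
    have h1 := auxGen_deg n (fun e => x (Sum.inl e))
    have h2 := auxGen_deg n (fun e => x (Sum.inr e))
    rcases hF.isUnit_or_isUnit h0.symm with hu | hu
    · have := MvPolynomial.totalDegree_mul (auxGen n (fun e => x (Sum.inl e)))
        (auxGen n (fun e => x (Sum.inr e)))
      rw [h0] at this
      have h3 := unit_deg _ hu
      have h4 : F.totalDegree ≤ _ := hdeg.symm.le.trans this
      omega
    · have := MvPolynomial.totalDegree_mul (auxGen n (fun e => x (Sum.inl e)))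
        (auxGen n (fun e => x (Sum.inr e)))
      rw [h0] at this
      have h3 := unit_deg _ hu
      have h4 : F.totalDegree ≤ _ := hdeg.symm.le.trans this
      omega)
  refine ⟨N * F.coeff e, mul_ne_zero hN0 he0, ?_⟩
  intro p _ hp
  have hp1 : ¬ (p : ℤ) ∣ N := fun h => hp (h.mul_right _)
  have hp2 : ¬ (p : ℤ) ∣ F.coeff e := fun h => hp (h.mul_left _)
  have hd2 := aux_deg_map (Int.castRingHom (ZMod p)) F e he
    (by simpa [ZMod.intCast_zmod_eq_zero_iff_dvd] using hp2)
  apply aux_irr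
  · omega
  · intro G H hG hH hGH
    rw [hd2] at hG hH
    let x : I ⊕ I → ZMod p := Sum.elim (fun e => G.coeff e.1) (fun e => H.coeff e.1)
    have h0 := hE _ x
    simp only [x, Sum.elim_inl, Sum.elim_inr] at h0
    rw [auxGen_coeff n G (by omega), auxGen_coeff n H (by omega), hGH, sub_self] at h0
    have hJ : J ≤ RingHom.ker (MvPolynomial.eval₂Hom (Int.castRingHom (ZMod p)) x) := by
      rw [Ideal.span_le]
      rintro _ ⟨d, rfl⟩
      have := congrArg (MvPolynomial.coeff d) h0
      rw [MvPolynomial.coeff_map] at this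
      simpa using this
    have := hJ hNJ
    rw [RingHom.mem_ker, MvPolynomial.eval₂Hom_C] at this
    exact hp1 ((ZMod.intCast_zmod_eq_zero_iff_dvd _ _).1 this)

theorem aux_prime_bar {τ B : Type*} [CommRing B]
    [IsDomain ((AlgebraicClosure ℚ) ⊗[ℤ] B)]
    (ev : MvPolynomial τ ℤ →ₐ[ℤ] B) (F : MvPolynomial τ ℤ) (hF0 : F ≠ 0)
    (hker : ∀ u, ev u = 0 ↔ F ∣ u) :
    Prime (MvPolynomial.map (algebraMap ℤ (AlgebraicClosure ℚ)) F) := by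
  let K := AlgebraicClosure ℚ
  let S := MvPolynomial τ ℤ
  let e : K ⊗[ℤ] S ≃ₐ[K] MvPolynomial τ K := MvPolynomial.algebraTensorAlgEquiv ℤ K
  let Φ : K ⊗[ℤ] S →ₐ[K] K ⊗[ℤ] B := Algebra.TensorProduct.map (AlgHom.id K K) ev
  have hΦ : ∀ z, Φ z = 0 ↔ (1 ⊗ₜ[ℤ] F : K ⊗[ℤ] S) ∣ z := by
    intro z
    constructor
    · intro hz
      have hex : Function.Exact (LinearMap.mulLeft ℤ F) ev.toLinearMap := by
        intro u
        simp only [AlgHom.toLinearMap_apply, hker, Set.mem_range, LinearMap.mulLeft_apply]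
        exact ⟨fun ⟨c, hc⟩ => ⟨c, hc.symm⟩, fun ⟨c, hc⟩ => ⟨c, hc.symm⟩⟩
      have hex2 := Module.Flat.lTensor_exact K hex
      obtain ⟨w, hw⟩ := (hex2 z).1 hz
      refine ⟨w, ?_⟩
      rw [← hw]
      clear hw
      induction w with
      | zero => simp
      | tmul a b => simp
      | add x y hx hy => rw [map_add, mul_add, hx, hy]
    · rintro ⟨w, rfl⟩
      rw [map_mul]
      have : ev F = 0 := (hker F).2 dvd_rfl
      simp [Φ, this]
  have heF : e (1 ⊗ₜ[ℤ] F) = MvPolynomial.map (algebraMap ℤ K) F := by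
    change MvPolynomial.algebraTensorAlgEquiv ℤ K (1 ⊗ₜ[ℤ] F) = _
    rw [MvPolynomial.algebraTensorAlgEquiv_tmul, one_smul]
  have hinj : Function.Injective (algebraMap ℤ K) := RingHom.injective_int _
  have hFb : MvPolynomial.map (algebraMap ℤ K) F ≠ 0 := by
    rw [Ne, map_eq_zero_iff _ (MvPolynomial.map_injective _ hinj)]
    exact hF0
  change Prime (MvPolynomial.map (algebraMap ℤ K) F)
  rw [← heF] at hFb ⊢
  rw [MulEquiv.prime_iff]
  have hpr : (RingHom.ker Φ.toRingHom).IsPrime := RingHom.ker_isPrime _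
  have hk : RingHom.ker Φ.toRingHom = Ideal.span {(1 ⊗ₜ[ℤ] F : K ⊗[ℤ] S)} := by
    ext z
    rw [Ideal.mem_span_singleton, RingHom.mem_ker]
    exact hΦ z
  rw [hk] at hpr
  refine (Ideal.span_singleton_prime ?_).1 hpr
  intro h
  rw [h, map_zero] at hFb
  exact hFb rfl

theorem aux_coprime_dvd {B : Type*} [CommRing B] (p : ℕ) [Fact p.Prime] (N : ℤ)
    (hN : ¬ (p : ℤ) ∣ N) (b : B) (h : (p : B) ∣ (N : B) * b) : (p : B) ∣ b := by
  have hc : IsCoprime (p : ℤ) N :=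
    (Nat.prime_iff_prime_int.1 Fact.out).coprime_iff_not_dvd.2 hN
  have : IsCoprime (p : B) (N : B) := by simpa using hc.map (Int.castRingHom B)
  exact this.dvd_of_dvd_mul_left h

theorem aux_torsion {B : Type*} [CommRing B] [IsDomain B] [CharZero B] [IsNoetherianRing B]
    (h : B) (hh : h ≠ 0) : ∃ N : ℤ, N ≠ 0 ∧ ∀ p : ℕ, [Fact p.Prime] → ¬ (p : ℤ) ∣ N →
      ∀ b : B, (p : B) ∣ h * b → (p : B) ∣ b := by
  let T : Ideal B :=
    { carrier := {b | ∃ n : ℤ, n ≠ 0 ∧ h ∣ (n : B) * b}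
      add_mem' := by
        rintro a b ⟨n, hn, ha⟩ ⟨m, hm, hb⟩
        refine ⟨n * m, mul_ne_zero hn hm, ?_⟩
        push_cast
        have : (n : B) * m * (a + b) = m * (n * a) + n * (m * b) := by ring
        rw [this]
        exact dvd_add (ha.mul_left _) (hb.mul_left _)
      zero_mem' := ⟨1, one_ne_zero, by simp⟩
      smul_mem' := by
        rintro c b ⟨n, hn, hb⟩
        refine ⟨n, hn, ?_⟩
        rw [smul_eq_mul, mul_left_comm]
        exact hb.mul_left _ }
  obtain ⟨S, hS⟩ := (isNoetherianRing_iff_ideal_fg B).1 inferInstance T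
  have hN : ∃ N : ℤ, N ≠ 0 ∧ ∀ b ∈ T, h ∣ (N : B) * b := by
    have hmem : ∀ x : S, ∃ n : ℤ, n ≠ 0 ∧ h ∣ (n : B) * x := by
      intro x
      have : (x : B) ∈ T := by
        rw [← hS]; exact Ideal.subset_span x.2
      exact this
    choose n hn0 hn using hmem
    refine ⟨∏ x, n x, Finset.prod_ne_zero_iff.2 fun x _ => hn0 x, ?_⟩
    intro b hb
    rw [← hS] at hb
    refine Submodule.span_induction ?_ ?_ ?_ ?_ hb
    · intro x hx
      obtain ⟨c, hc⟩ := Finset.dvd_prod_of_mem n (Finset.mem_univ (⟨x, hx⟩ : S))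
      rw [hc]
      push_cast
      have := hn ⟨x, hx⟩
      rw [mul_right_comm]
      exact this.mul_right _
    · simp
    · intro x y _ _ hx hy
      rw [mul_add]; exact dvd_add hx hy
    · intro a x _ hx
      rw [smul_eq_mul, mul_left_comm]
      exact hx.mul_left _
  obtain ⟨N, hN0, hN⟩ := hN
  refine ⟨N, hN0, ?_⟩
  intro p hp hpN b hb
  obtain ⟨c, hc⟩ := hb
  have hp0 : (p : B) ≠ 0 := by exact_mod_cast hp.out.ne_zero
  have hcT : c ∈ T := ⟨p, by exact_mod_cast hp.out.ne_zero, by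
    push_cast
    rw [← hc]; exact dvd_mul_right _ _⟩
  obtain ⟨c', hc'⟩ := hN c hcT
  apply aux_coprime_dvd p N hpN
  refine ⟨c', ?_⟩
  apply mul_left_cancel₀ hh
  calc h * (N * b) = N * (h * b) := by ring
    _ = p * (N * c) := by rw [hc]; ring
    _ = _ := by rw [hc']; ring

theorem aux_domain_mod {τ B : Type*} [CommRing B] [IsDomain B] [CharZero B] [IsNoetherianRing B]
    (ev : MvPolynomial τ ℤ →ₐ[ℤ] B) (F : MvPolynomial τ ℤ)
    (hker : ∀ u, ev u = 0 ↔ F ∣ u) (h : B) (hh : h ≠ 0)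
    (hr : h ∈ ev.range) (hloc : ∀ b, ∃ k : ℕ, h ^ k * b ∈ ev.range)
    (N₁ : ℤ) (hN₁0 : N₁ ≠ 0) (hN₁ : ∀ p : ℕ, [Fact p.Prime] → ¬ (p : ℤ) ∣ N₁ →
      Irreducible (MvPolynomial.map (Int.castRingHom (ZMod p)) F)) :
    ∃ N : ℤ, N ≠ 0 ∧ ∀ p : ℕ, [Fact p.Prime] → ¬ (p : ℤ) ∣ N →
      ∀ f g : B, (p : B) ∣ f * g → (p : B) ∣ f ∨ (p : B) ∣ g := by
  obtain ⟨N₂, hN₂0, hN₂⟩ := aux_torsion h hh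
  refine ⟨N₁ * N₂, mul_ne_zero hN₁0 hN₂0, ?_⟩
  intro p hp hpN f g hfg
  have hp1 : ¬ (p : ℤ) ∣ N₁ := fun h => hpN (h.mul_right _)
  have hp2 : ¬ (p : ℤ) ∣ N₂ := fun h => hpN (h.mul_left _)
  have hpr : Prime (MvPolynomial.map (Int.castRingHom (ZMod p)) F) := (hN₁ p hp1).prime
  have hpow : ∀ (k : ℕ) (b : B), (p : B) ∣ h ^ k * b → (p : B) ∣ b := by
    intro k
    induction k with
    | zero => intro b hb; simpa using hb
    | succ k ih =>
      intro b hb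
      apply ih
      apply hN₂ p hp2
      rwa [pow_succ', mul_assoc] at hb
  obtain ⟨c, hc⟩ := hfg
  obtain ⟨k₁, hk₁⟩ := hloc f
  obtain ⟨k₂, hk₂⟩ := hloc g
  obtain ⟨k₃, hk₃⟩ := hloc c
  obtain ⟨u, hu⟩ := hk₁
  obtain ⟨v, hv⟩ := hk₂
  obtain ⟨w, hw⟩ := hk₃
  obtain ⟨η, hη⟩ := hr
  have key : ∀ u v w : MvPolynomial τ ℤ, ev u * ev v = p * ev w →
      (p : B) ∣ ev u ∨ (p : B) ∣ ev v := by
    intro u v w huv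
    have h1 : ev (u * v - (p : MvPolynomial τ ℤ) * w) = 0 := by
      rw [map_sub, map_mul, map_mul, map_natCast, huv, sub_self]
    rw [hker] at h1
    obtain ⟨z, hz⟩ := h1
    have h2 := congrArg (MvPolynomial.map (Int.castRingHom (ZMod p))) hz
    simp only [map_sub, map_mul, map_natCast] at h2
    have hp0 : ((p : ℕ) : MvPolynomial τ (ZMod p)) = 0 := by
      rw [← map_natCast (MvPolynomial.C (σ := τ) (R := ZMod p)), CharP.cast_eq_zero, map_zero]
    rw [hp0, zero_mul, sub_zero] at h2
    have lift : ∀ u : MvPolynomial τ ℤ, MvPolynomial.map (Int.castRingHom (ZMod p)) F ∣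
        MvPolynomial.map (Int.castRingHom (ZMod p)) u → (p : B) ∣ ev u := by
      rintro u ⟨x, hx⟩
      obtain ⟨x, rfl⟩ := MvPolynomial.map_surjective (Int.castRingHom (ZMod p))
        (ZMod.ringHom_surjective _) x
      rw [← map_mul, ← sub_eq_zero, ← map_sub] at hx
      have : (MvPolynomial.C (p : ℤ)) ∣ u - F * x := by
        rw [MvPolynomial.C_dvd_iff_dvd_coeff]
        intro i
        have h5 := congrArg (MvPolynomial.coeff i) hx
        rw [MvPolynomial.coeff_map, MvPolynomial.coeff_zero] at h5
        exact (ZMod.intCast_zmod_eq_zero_iff_dvd _ _).1 h5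
      obtain ⟨y, hy⟩ := this
      refine ⟨ev y, ?_⟩
      have h6 := congrArg ev hy
      rw [map_sub, map_mul, map_mul, (hker F).2 dvd_rfl] at h6
      simpa using h6
    rcases hpr.dvd_or_dvd (Dvd.intro _ h2.symm) with h3 | h3
    · exact Or.inl (lift u h3)
    · exact Or.inr (lift v h3)
  change ev u = _ at hu
  change ev v = _ at hv
  change ev w = _ at hw
  change ev η = _ at hη
  rcases key (η ^ k₃ * u) v (η ^ (k₁ + k₂) * w) (by
    rw [map_mul, map_mul, map_pow, map_pow, hu, hv, hw, hη]
    calc h ^ k₃ * (h ^ k₁ * f) * (h ^ k₂ * g) = h ^ (k₁ + k₂) * h ^ k₃ * (f * g) := by ring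
      _ = _ := by rw [hc]; ring) with h1 | h1
  · left
    rw [map_mul, map_pow, hu, hη] at h1
    exact hpow _ _ (hpow _ _ h1)
  · right
    rw [hv] at h1
    exact hpow _ _ h1

theorem aux_prim {A B : Type*} [CommRing A] [IsDomain A] [CharZero A] [CommRing B] [IsDomain B]
    [Algebra A B] [FaithfulSMul A B] [Algebra.IsAlgebraic A B] [Algebra.FiniteType A B] :
    ∃ θ : B, IsIntegral A θ ∧ ∃ h : A, h ≠ 0 ∧
      ∀ b : B, ∃ k : ℕ, (algebraMap A B h) ^ k * b ∈ Algebra.adjoin A {θ} := by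
  let K := FractionRing A
  let L := FractionRing B
  have : FaithfulSMul A L := by
    rw [faithfulSMul_iff_algebraMap_injective, IsScalarTower.algebraMap_eq A B L]
    exact (IsFractionRing.injective B L).comp (FaithfulSMul.algebraMap_injective A B)
  let : Algebra K L := FractionRing.liftAlgebra A L
  have : IsScalarTower A K L := FractionRing.isScalarTower_liftAlgebra A L
  have hAL : Algebra.IsAlgebraic A L := (IsFractionRing.isAlgebraic_iff' A B L).1 inferInstance
  have hKL : Algebra.IsAlgebraic K L := (IsFractionRing.comap_isAlgebraic_iff (A := A) (K := K)).1 hAL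
  have : Algebra.EssFiniteType B L := Algebra.EssFiniteType.of_isLocalization L (nonZeroDivisors B)
  have : Algebra.EssFiniteType A L := Algebra.EssFiniteType.comp A B L
  have : Algebra.EssFiniteType K L := Algebra.EssFiniteType.of_comp A K L
  have : Module.Finite K L := Algebra.finite_of_essFiniteType_of_isAlgebraic
  have : CharZero K := charZero_of_injective_algebraMap (IsFractionRing.injective A K)
  obtain ⟨α, hα⟩ := Field.exists_primitive_element K L
  have hinjB : Function.Injective (algebraMap B L) := IsFractionRing.injective B L
  have hinjA : Function.Injective (algebraMap A B) := FaithfulSMul.algebraMap_injective A B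
  -- scale
  have hscale : ∃ θ : B, IsIntegral A θ ∧ ∃ c : A, c ≠ 0 ∧ algebraMap B L θ = algebraMap A L c * α := by
    obtain ⟨u, v, hv, rfl⟩ := IsFractionRing.div_surjective (A := B) α
    obtain ⟨a, ha0, w, hw⟩ := (Algebra.IsAlgebraic.isAlgebraic (R := A) v).exists_nonzero_dvd hv
    obtain ⟨y, hy0, hy⟩ := (Algebra.IsAlgebraic.isAlgebraic (R := A) (u * w)).exists_integral_multiple
    refine ⟨y • (u * w), hy, y * a, mul_ne_zero hy0 ha0, ?_⟩
    have hv0 : algebraMap B L v ≠ 0 := by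
      rw [Ne, map_eq_zero_iff _ hinjB]; exact nonZeroDivisors.ne_zero hv
    rw [Algebra.smul_def, IsScalarTower.algebraMap_apply A B L, map_mul, map_mul (algebraMap A B), hw]
    simp only [map_mul]
    rw [eq_comm, mul_div_assoc', div_eq_iff hv0]
    ring
  obtain ⟨θ, hθ, c, hc0, hc⟩ := hscale
  have hc0L : algebraMap A L c ≠ 0 := by
    rw [Ne, map_eq_zero_iff _ (FaithfulSMul.algebraMap_injective A L)]; exact hc0
  have htop : IntermediateField.adjoin K {algebraMap B L θ} = ⊤ := by
    rw [eq_top_iff, ← hα, IntermediateField.adjoin_simple_le_iff]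
    have h1 : α = algebraMap K L (algebraMap A K c)⁻¹ * algebraMap B L θ := by
      rw [map_inv₀, ← IsScalarTower.algebraMap_apply A K L, hc, inv_mul_cancel_left₀ hc0L]
    rw [h1]
    exact mul_mem (IntermediateField.algebraMap_mem _ _) (IntermediateField.mem_adjoin_simple_self _ _)
  rw [IntermediateField.adjoin_eq_top_iff] at htop
  have hb : ∀ b : B, ∃ h : A, h ≠ 0 ∧ algebraMap A B h * b ∈ Algebra.adjoin A {θ} := by
    intro b
    have hmem : algebraMap B L b ∈ Algebra.adjoin K {algebraMap B L θ} := by rw [htop]; trivial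
    rw [Algebra.adjoin_singleton_eq_range_aeval] at hmem
    obtain ⟨q, hq⟩ := hmem
    obtain ⟨d, hd, hdq⟩ := IsLocalization.integerNormalization_spec (nonZeroDivisors A) q
    refine ⟨d, nonZeroDivisors.ne_zero hd, ?_⟩
    rw [Algebra.adjoin_singleton_eq_range_aeval]
    refine ⟨IsLocalization.integerNormalization (nonZeroDivisors A) q, ?_⟩
    apply hinjB
    change Polynomial.aeval _ q = _ at hq
    have h2 := congrArg (Polynomial.aeval (algebraMap B L θ)) hdq
    rw [Polynomial.aeval_map_algebraMap, Polynomial.aeval_algebraMap_apply] at h2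
    change algebraMap B L (Polynomial.aeval θ _) = _
    rw [h2, ← algebraMap_smul K d q, map_smul, hq, map_mul, ← IsScalarTower.algebraMap_apply A B L, Algebra.smul_def, ← IsScalarTower.algebraMap_apply A K L]
  choose η hη0 hη using hb
  obtain ⟨S, hS⟩ := (inferInstance : Algebra.FiniteType A B)
  refine ⟨θ, hθ, ∏ x ∈ S, η x, Finset.prod_ne_zero_iff.2 fun x _ => hη0 x, ?_⟩
  intro b
  have hmem : b ∈ Algebra.adjoin A (S : Set B) := by rw [hS]; trivial
  have hpow : ∀ k : ℕ, (algebraMap A B (∏ x ∈ S, η x)) ^ k ∈ Algebra.adjoin A {θ} := fun k =>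
    pow_mem (Subalgebra.algebraMap_mem _ _) k
  induction hmem using Algebra.adjoin_induction with
  | mem x hx =>
    refine ⟨1, ?_⟩
    obtain ⟨z, hz⟩ := Finset.dvd_prod_of_mem η hx
    rw [hz, pow_one, map_mul, mul_right_comm]
    exact mul_mem (hη x) (Subalgebra.algebraMap_mem _ _)
  | algebraMap r => exact ⟨0, by simp⟩
  | add x y _ _ hx hy =>
    obtain ⟨k, hk⟩ := hx
    obtain ⟨l, hl⟩ := hy
    refine ⟨k + l, ?_⟩
    rw [mul_add, pow_add]
    refine add_mem ?_ ?_
    · rw [mul_right_comm]; exact mul_mem hk (hpow l)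
    · rw [mul_assoc]; exact mul_mem (hpow k) hl
  | mul x y _ _ hx hy =>
    obtain ⟨k, hk⟩ := hx
    obtain ⟨l, hl⟩ := hy
    refine ⟨k + l, ?_⟩
    rw [pow_add, mul_mul_mul_comm]
    exact mul_mem hk hl

theorem aux_good {n : ℕ} {B : Type*} [CommRing B] [IsDomain B] [CharZero B]
    [IsDomain ((AlgebraicClosure ℚ) ⊗[ℤ] B)] [Algebra.FiniteType ℤ B]
    [Algebra (MvPolynomial (Fin n) ℤ) B] [FaithfulSMul (MvPolynomial (Fin n) ℤ) B]
    [Algebra.IsAlgebraic (MvPolynomial (Fin n) ℤ) B] :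
    ∃ N : ℤ, N ≠ 0 ∧ ∀ p : ℕ, [Fact p.Prime] → ¬ (p : ℤ) ∣ N →
      ∀ f g : B, (p : B) ∣ f * g → (p : B) ∣ f ∨ (p : B) ∣ g := by
  have : IsNoetherianRing B := Algebra.FiniteType.isNoetherianRing ℤ B
  have : Algebra.FiniteType (MvPolynomial (Fin n) ℤ) B :=
    Algebra.FiniteType.of_restrictScalars_finiteType ℤ _ _
  obtain ⟨θ, hθ, h, hh0, hloc⟩ := aux_prim (A := MvPolynomial (Fin n) ℤ) (B := B)
  let e := MvPolynomial.optionEquivLeft ℤ (Fin n)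
  let ev : MvPolynomial (Option (Fin n)) ℤ →ₐ[ℤ] B :=
    ((Polynomial.aeval (R := MvPolynomial (Fin n) ℤ) θ).restrictScalars ℤ).comp e.toAlgHom
  have hev : ∀ u, ev u = Polynomial.aeval θ (e u) := fun u => rfl
  let F := e.symm (minpoly (MvPolynomial (Fin n) ℤ) θ)
  have hF0 : F ≠ 0 := by
    rw [Ne, EmbeddingLike.map_eq_zero_iff]
    exact minpoly.ne_zero hθ
  have hker : ∀ u, ev u = 0 ↔ F ∣ u := by
    intro u
    rw [hev, minpoly.isIntegrallyClosed_dvd_iff hθ]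
    rw [← map_dvd_iff e]
    simp [F]
  have hrange : ∀ x ∈ Algebra.adjoin (MvPolynomial (Fin n) ℤ) {θ}, x ∈ ev.range := by
    intro x hx
    rw [Algebra.adjoin_singleton_eq_range_aeval] at hx
    obtain ⟨q, hq⟩ := hx
    refine ⟨e.symm q, ?_⟩
    change ev (e.symm q) = x
    rw [hev, AlgEquiv.apply_symm_apply]
    exact hq
  have hirr := (aux_prime_bar ev F hF0 hker).irreducible
  obtain ⟨N₁, hN₁0, hN₁⟩ := aux_irr_mod F hirr
  refine aux_domain_mod ev F hker (algebraMap _ B h) ?_ (hrange _ (Subalgebra.algebraMap_mem _ _))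
    ?_ N₁ hN₁0 hN₁
  · rwa [Ne, map_eq_zero_iff _ (FaithfulSMul.algebraMap_injective _ _)]
  · intro b
    obtain ⟨k, hk⟩ := hloc b
    exact ⟨k, hrange _ hk⟩

def auxRep {n m : ℕ} {k A : Type*} [Field k] [CommRing A] [Algebra k A]
    (t : Fin n → A) (b : Fin m → A) (e : ℕ) (a : A) : Prop :=
  ∃ F : Matrix (Fin m) (Fin m) (MvPolynomial (Fin n) k), (∀ i j, (F i j).totalDegree ≤ e) ∧
    ∀ j, a * b j = ∑ l, MvPolynomial.aeval t (F j l) * b l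

section
variable {n m : ℕ} {k A : Type*} [Field k] [CommRing A] [Algebra k A]
    {t : Fin n → A} {b : Fin m → A}

theorem auxRep_mono {e e' : ℕ} (h : e ≤ e') {a : A} (ha : auxRep (k := k) t b e a) :
    auxRep (k := k) t b e' a := by
  obtain ⟨F, h1, h2⟩ := ha
  exact ⟨F, fun i j => (h1 i j).trans h, h2⟩

theorem auxRep_zero (e : ℕ) : auxRep (k := k) t b e 0 :=
  ⟨0, by simp, by simp⟩

theorem auxRep_add {e : ℕ} {a a' : A} (h : auxRep (k := k) t b e a)
    (h' : auxRep (k := k) t b e a') : auxRep (k := k) t b e (a + a') := by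
  obtain ⟨F, h1, h2⟩ := h
  obtain ⟨G, h3, h4⟩ := h'
  refine ⟨F + G, fun i j => ?_, fun j => ?_⟩
  · exact (MvPolynomial.totalDegree_add _ _).trans (max_le (h1 i j) (h3 i j))
  · simp [add_mul, h2, h4, Finset.sum_add_distrib]

theorem auxRep_mul {e e' : ℕ} {a a' : A} (h : auxRep (k := k) t b e a)
    (h' : auxRep (k := k) t b e' a') : auxRep (k := k) t b (e + e') (a * a') := by
  obtain ⟨F, h1, h2⟩ := h
  obtain ⟨G, h3, h4⟩ := h'
  refine ⟨G * F, fun i j => ?_, fun j => ?_⟩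
  · rw [Matrix.mul_apply]
    refine MvPolynomial.totalDegree_finsetSum_le fun l _ => ?_
    refine (MvPolynomial.totalDegree_mul _ _).trans ?_
    have := h1 l j
    have := h3 i l
    lia
  · rw [mul_assoc, h4, Finset.mul_sum]
    simp_rw [Matrix.mul_apply, map_sum, map_mul, Finset.sum_mul]
    rw [Finset.sum_comm]
    refine Finset.sum_congr rfl fun l _ => ?_
    rw [mul_left_comm, h2, Finset.mul_sum]
    simp_rw [mul_assoc]

theorem auxRep_alg (c : k) : auxRep (k := k) t b 0 (algebraMap k A c) := by
  refine ⟨fun i j => if i = j then MvPolynomial.C c else 0, fun i j => ?_, fun j => ?_⟩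
  · dsimp only
    split_ifs <;> simp
  · simp [apply_ite, ite_mul]

theorem auxRep_pow {e : ℕ} {a : A} (h : auxRep (k := k) t b e a) (N : ℕ) :
    auxRep (k := k) t b (N * e) (a ^ N) := by
  induction N with
  | zero => simpa using auxRep_alg (k := k) (t := t) (b := b) 1
  | succ N ih =>
    rw [pow_succ, Nat.succ_mul]
    exact auxRep_mul ih h

theorem auxRep_prod {ι : Type*} (S : Finset ι) (e : ι → ℕ) (a : ι → A)
    (h : ∀ i, auxRep (k := k) t b (e i) (a i)) :
    auxRep (k := k) t b (∑ i ∈ S, e i) (∏ i ∈ S, a i) := by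
  classical
  induction S using Finset.induction_on with
  | empty => simpa using auxRep_alg (k := k) (t := t) (b := b) 1
  | insert x S hx ih =>
    rw [Finset.sum_insert hx, Finset.prod_insert hx]
    exact auxRep_mul (h x) ih

theorem auxRep_aeval {r D d : ℕ} (y : Fin r → A) (hy : ∀ i, auxRep (k := k) t b D (y i))
    (q : MvPolynomial (Fin r) k) (hq : q.totalDegree ≤ d) :
    auxRep (k := k) t b (d * D) (MvPolynomial.aeval y q) := by
  rw [MvPolynomial.aeval_def, MvPolynomial.eval₂_eq']
  refine Finset.sum_induction _ _ (fun _ _ => auxRep_add) (auxRep_zero _) fun e he => ?_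
  have h1 := auxRep_mul (auxRep_alg (k := k) (t := t) (b := b) (q.coeff e))
    (auxRep_prod (k := k) (t := t) (b := b) Finset.univ (fun i => e i * D) (fun i => y i ^ e i)
      (fun i => auxRep_pow (hy i) _))
  refine auxRep_mono ?_ h1
  rw [zero_add, ← Finset.sum_mul]
  refine Nat.mul_le_mul_right _ (le_trans ?_ hq)
  have := MvPolynomial.le_totalDegree he
  rwa [Finsupp.sum_fintype _ _ (by simp)] at this
end

theorem aux_coeff_deg {n m E : ℕ} {k : Type*} [Field k]
    (F : Matrix (Fin m) (Fin m) (MvPolynomial (Fin n) k))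
    (hF : ∀ i j, (F i j).totalDegree ≤ E) (i : ℕ) :
    (F.charpoly.coeff i).totalDegree ≤ m * E := by
  let P : ℕ → Polynomial (MvPolynomial (Fin n) k) → Prop :=
    fun e p => ∀ i, (p.coeff i).totalDegree ≤ e
  have hmul : ∀ e e' p q, P e p → P e' q → P (e + e') (p * q) := by
    intro e e' p q hp hq i
    rw [Polynomial.coeff_mul]
    refine MvPolynomial.totalDegree_finsetSum_le fun l _ => ?_
    refine (MvPolynomial.totalDegree_mul _ _).trans ?_
    exact add_le_add (hp _) (hq _)
  have hent : ∀ i j, P E (F.charmatrix i j) := by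
    intro i j l
    rw [Matrix.charmatrix_apply, Polynomial.coeff_sub]
    refine (MvPolynomial.totalDegree_sub _ _).trans (max_le ?_ ?_)
    · rw [Matrix.diagonal_apply]
      split_ifs
      · rw [Polynomial.coeff_X]
        split_ifs <;> simp
      · simp
    · rw [Polynomial.coeff_C]
      split_ifs
      · exact hF _ _
      · simp
  have hprod : ∀ (g : Fin m → Fin m) (S : Finset (Fin m)),
      P (S.card * E) (∏ i ∈ S, F.charmatrix (g i) i) := by
    intro g S
    induction S using Finset.induction_on with
    | empty =>
      intro i
      rw [Finset.prod_empty, Polynomial.coeff_one]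
      split_ifs <;> simp
    | insert x S hx ih =>
      rw [Finset.prod_insert hx, Finset.card_insert_of_notMem hx, Nat.succ_mul, add_comm]
      exact hmul _ _ _ _ (hent _ _) ih
  rw [Matrix.charpoly, Matrix.det_apply, Polynomial.finsetSum_coeff]
  refine MvPolynomial.totalDegree_finsetSum_le fun σ _ => ?_
  have := hprod σ Finset.univ i
  rw [Finset.card_univ, Fintype.card_fin] at this
  rcases Int.units_eq_one_or (Equiv.Perm.sign σ) with h | h <;> rw [h]
  · simpa using this
  · simpa using this

theorem aux_cayley {n m : ℕ} {k A : Type*} [CommRing k] [CommRing A] [Algebra k A]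
    (t : Fin n → A) (b : Fin m → A) (hone : ∀ a : A, (∀ j, a * b j = 0) → a = 0)
    (a : A) (F : Matrix (Fin m) (Fin m) (MvPolynomial (Fin n) k))
    (hF : ∀ j, a * b j = ∑ l, MvPolynomial.aeval t (F j l) * b l) :
    Polynomial.eval₂ (MvPolynomial.aeval t : MvPolynomial (Fin n) k →ₐ[k] A).toRingHom a
      F.charpoly = 0 := by
  set τ := (MvPolynomial.aeval t : MvPolynomial (Fin n) k →ₐ[k] A).toRingHom with hτ
  rw [Polynomial.eval₂_eq_eval_map, ← Matrix.charpoly_map, Matrix.eval_charpoly]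
  set G := Matrix.scalar (Fin m) a - F.map τ with hG
  have h0 : G.mulVec b = 0 := by
    funext j
    rw [hG, Matrix.sub_mulVec, Pi.sub_apply]
    simp only [Matrix.mulVec, dotProduct, Matrix.scalar_apply, Matrix.diagonal_apply,
      Matrix.map_apply]
    simp [hF, hτ]
  have h1 : ∀ j, G.det * b j = 0 := by
    intro j
    have : (G.adjugate * G).mulVec b = 0 := by
      rw [← Matrix.mulVec_mulVec, h0, Matrix.mulVec_zero]
    rw [Matrix.adjugate_mul, Matrix.smul_mulVec, Matrix.one_mulVec] at this
    exact congrFun this j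
  exact hone _ h1

theorem aux_count {n r m D d : ℕ} {k A : Type*} [Field k] [Fintype k] [CommRing A] [Algebra k A]
    [NoZeroDivisors A] (y : Fin r → A) (hy : Function.Surjective (MvPolynomial.aeval (R := k) y))
    (t : Fin n → A) (b : Fin m → A) (hone : ∀ a : A, (∀ j, a * b j = 0) → a = 0)
    (hM : ∀ i, auxRep (k := k) t b D (y i))
    (q : MvPolynomial (Fin r) k) (hq : q.totalDegree ≤ d) (hf : MvPolynomial.aeval y q ≠ 0) :
    Nat.card {φ : A →ₐ[k] k // φ (MvPolynomial.aeval y q) = 0} * Fintype.card k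
      ≤ (m ^ r * (m * (d * D))) * Fintype.card k ^ n := by
  classical
  set f := MvPolynomial.aeval y q with hfdef
  obtain ⟨F, hFd, hF⟩ := auxRep_aeval y hM q hq
  have hroot := aux_cayley t b hone f F hF
  set τ := (MvPolynomial.aeval t : MvPolynomial (Fin n) k →ₐ[k] A).toRingHom with hτ
  obtain ⟨P, hP0, hPd, hPdvd⟩ : ∃ P : MvPolynomial (Fin n) k, P ≠ 0 ∧
      P.totalDegree ≤ m * (d * D) ∧ f ∣ τ P := by
    have hne : F.charpoly ≠ 0 := (Matrix.charpoly_monic F).ne_zero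
    obtain ⟨ψ, hψ, hψX⟩ := Polynomial.exists_eq_pow_rootMultiplicity_mul_and_not_dvd _ hne 0
    set K := Polynomial.rootMultiplicity 0 F.charpoly
    rw [map_zero, sub_zero] at hψ hψX
    rw [Polynomial.X_dvd_iff] at hψX
    refine ⟨ψ.coeff 0, hψX, ?_, ?_⟩
    · have := aux_coeff_deg F hFd K
      rw [hψ] at this
      simpa [Polynomial.coeff_X_pow_mul'] using this
    · rw [hψ, Polynomial.eval₂_mul, Polynomial.eval₂_pow, Polynomial.eval₂_X] at hroot
      have h1 := (mul_eq_zero.mp hroot).resolve_left (pow_ne_zero _ hf)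
      rw [← Polynomial.divX_mul_X_add ψ, Polynomial.eval₂_add, Polynomial.eval₂_mul,
        Polynomial.eval₂_X, Polynomial.eval₂_C] at h1
      rw [eq_neg_of_add_eq_zero_right h1]
      exact (Dvd.intro_left _ rfl).neg_right
  choose M hMd hM using hM
  have hinj : Function.Injective (fun (φ : A →ₐ[k] k) (i : Fin r) => φ (y i)) := by
    intro φ φ' h
    apply AlgHom.ext
    intro a
    obtain ⟨u, rfl⟩ := hy a
    have : φ.comp (MvPolynomial.aeval y) = φ'.comp (MvPolynomial.aeval y) := by
      apply MvPolynomial.algHom_ext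
      intro i
      simpa using congrFun h i
    exact congrArg (fun z => z u) this
  have : Finite (A →ₐ[k] k) := Finite.of_injective _ hinj
  have := Fintype.ofFinite (A →ₐ[k] k)
  have hcomm : ∀ (φ : A →ₐ[k] k) (u : MvPolynomial (Fin n) k),
      φ (τ u) = MvPolynomial.eval (fun i => φ (t i)) u := by
    intro φ u
    have : φ.comp (MvPolynomial.aeval t) = MvPolynomial.aeval (fun i => φ (t i)) := by
      apply MvPolynomial.algHom_ext
      intro i
      simp
    have := congrArg (fun z => z u) this
    have h5 : φ (MvPolynomial.aeval t u) = MvPolynomial.eval (fun i => φ (t i)) u := by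
      simpa [MvPolynomial.aeval_eq_eval] using this
    exact h5
  have hfib : ∀ x : Fin n → k,
      ({φ : A →ₐ[k] k | φ f = 0 ∧ (fun i => φ (t i)) = x} : Finset _).card ≤ m ^ r := by
    intro x
    have h1 : ∀ i, (((M i).map (MvPolynomial.eval x)).charpoly.roots.toFinset).card ≤ m := by
      intro i
      refine (Multiset.toFinset_card_le _).trans ((Polynomial.card_roots' _).trans ?_)
      rw [Matrix.charpoly_natDegree_eq_dim, Fintype.card_fin]
    have h2 : (Fintype.piFinset fun i : Fin r =>
        ((M i).map (MvPolynomial.eval x)).charpoly.roots.toFinset).card ≤ m ^ r := by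
      rw [Fintype.card_piFinset]
      refine (Finset.prod_le_prod' fun i _ => h1 i).trans ?_
      simp
    refine le_trans (Finset.card_le_card_of_injOn _ ?_ (hinj.injOn)) h2
    intro φ hφ
    simp only [Finset.coe_filter, Finset.mem_univ, true_and, Set.mem_ofPred_eq] at hφ
    rw [Finset.mem_coe, Fintype.mem_piFinset]
    intro i
    rw [Multiset.mem_toFinset, Polynomial.mem_roots (Matrix.charpoly_monic _).ne_zero,
      Polynomial.IsRoot.def, Matrix.charpoly_map, Polynomial.eval_map]
    have h3 := aux_cayley t b hone (y i) (M i) (hM i)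
    have h4 := congrArg φ h3
    rw [map_zero, ← RingHom.coe_coe φ, Polynomial.hom_eval₂] at h4
    rw [← h4]
    congr 1
    ext u
    · simp
    · simp [← hφ.2]
  have hcard : Nat.card {φ : A →ₐ[k] k // φ f = 0} =
      ({φ : A →ₐ[k] k | φ f = 0} : Finset _).card := by
    rw [Nat.card_eq_fintype_card, Fintype.card_subtype]
  have hbd : Nat.card {φ : A →ₐ[k] k // φ f = 0} ≤ m ^ r *
      ({x ∈ Fintype.piFinset (fun _ : Fin n => (Finset.univ : Finset k)) |
        MvPolynomial.eval x P = 0}).card := by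
    rw [hcard]
    refine Finset.card_le_mul_card_image_of_maps_to (f := fun φ i => φ (t i)) ?_ _ ?_
    · intro φ hφ
      simp only [Finset.mem_filter, Finset.mem_univ, true_and] at hφ
      simp only [Finset.mem_filter, Fintype.mem_piFinset, Finset.mem_univ, implies_true, true_and]
      rw [← hcomm]
      obtain ⟨g, hg⟩ := hPdvd
      rw [hg, map_mul, hφ, zero_mul]
    · intro x hx
      rw [Finset.filter_filter]
      exact hfib x
  have hsz := MvPolynomial.schwartz_zippel_totalDegree hP0 (Finset.univ : Finset k)
  have hk : (0 : ℚ≥0) < (Fintype.card k : ℚ≥0) := by exact_mod_cast Fintype.card_pos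
  rw [Finset.card_univ, div_le_div_iff₀ (by positivity) hk] at hsz
  have hsz' : ({x ∈ Fintype.piFinset (fun _ : Fin n => (Finset.univ : Finset k)) |
        MvPolynomial.eval x P = 0}).card * Fintype.card k ≤ P.totalDegree * Fintype.card k ^ n := by
    exact_mod_cast hsz
  calc _ ≤ _ := Nat.mul_le_mul_right _ hbd
    _ ≤ _ := by
      rw [mul_assoc, mul_assoc]
      refine Nat.mul_le_mul_left _ (hsz'.trans ?_)
      exact Nat.mul_le_mul_right _ hPd

theorem aux_dim {n s : ℕ} {R : Type*} [CommRing R] [IsDomain R]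
    (g : MvPolynomial (Fin n) ℚ →+* R) (hg : Function.Injective g) (hfin : g.Finite)
    (hdim : ringKrullDim R = (s : WithBot (WithTop ℕ))) : n ≤ s := by
  algebraize [g]
  have h1 : ringKrullDim (MvPolynomial (Fin n) ℚ) = n := by
    rw [MvPolynomial.ringKrullDim_of_isNoetherianRing, ringKrullDim_eq_zero_of_field]
    simp
  have : FaithfulSMul (MvPolynomial (Fin n) ℚ) R :=
    (faithfulSMul_iff_algebraMap_injective _ _).mpr hg
  obtain ⟨l, hl⟩ := Order.le_krullDim_iff.mp h1.ge
  obtain ⟨P, hP⟩ := Algebra.IsIntegral.comap_surjective (MvPolynomial (Fin n) ℚ) R l.head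
  have : P.asIdeal.LiesOver (RelSeries.head l).asIdeal := ⟨by rw [← hP]; rfl⟩
  obtain ⟨L, hL, -⟩ := Ideal.exists_ltSeries_of_hasGoingUp l P.asIdeal
  have h2 : (n : WithBot ℕ∞) ≤ ringKrullDim R := Order.le_krullDim_iff.mpr ⟨L, hL.trans hl⟩
  rw [hdim] at h2
  exact (Nat.cast_le (α := WithBot ℕ∞)).mp h2

theorem aux_clear {σ J : Type*} [Finite J] (c : J → MvPolynomial σ ℚ) :
    ∃ N : ℤ, N ≠ 0 ∧ ∃ c' : J → MvPolynomial σ ℤ,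
      ∀ j, MvPolynomial.map (Int.castRingHom ℚ) (c' j) = MvPolynomial.C (N : ℚ) * c j := by
  let := MvPolynomial.algebraMvPolynomial (σ := σ) (R := ℤ) (S := ℚ)
  obtain ⟨⟨v, hv⟩, h⟩ := IsLocalization.exist_integer_multiples_of_finite
    ((nonZeroDivisors ℤ).map (MvPolynomial.C (σ := σ))) c
  obtain ⟨N, hN, rfl⟩ := hv
  choose c' hc' using h
  refine ⟨N, nonZeroDivisors.ne_zero hN, c', fun j => ?_⟩
  have := hc' j
  change _ = (MvPolynomial.C N : MvPolynomial σ ℤ) • c j at this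
  rw [Algebra.smul_def, MvPolynomial.algebraMap_def, MvPolynomial.map_C] at this
  exact this

/-- Integral Noether normalisation data. -/
theorem aux_noether {r s : ℕ} {B : Type*} [CommRing B] [IsDomain B] [CharZero B]
    [Algebra.FiniteType ℤ B] [Module.Flat ℤ B] [IsDomain (ℚ ⊗[ℤ] B)]
    (hdim : ringKrullDim (ℚ ⊗[ℤ] B) = (s : WithBot (WithTop ℕ))) (y : Fin r → B) :
    ∃ (n : ℕ) (t : Fin n → B), n ≤ s ∧
      Function.Injective (MvPolynomial.aeval (R := ℤ) t) ∧
      (∀ x : B, ∃ q : Polynomial (MvPolynomial (Fin n) ℤ), q ≠ 0 ∧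
        Polynomial.eval₂ (MvPolynomial.aeval (R := ℤ) t).toRingHom x q = 0) ∧
      ∃ (m : ℕ) (b : Fin m → B) (N : ℤ)
        (M : Fin r → Matrix (Fin m) (Fin m) (MvPolynomial (Fin n) ℤ))
        (c : Fin m → B),
        N ≠ 0 ∧
        (∀ i j, (N : B) * (y i * b j) = ∑ l, MvPolynomial.aeval t (M i j l) * b l) ∧
        (N : B) = ∑ l, c l * b l := by
  let ι : B →+* (ℚ ⊗[ℤ] B) := (Algebra.TensorProduct.includeRight : B →ₐ[ℤ] ℚ ⊗[ℤ] B).toRingHom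
  have hι : Function.Injective ι :=
    Algebra.TensorProduct.includeRight_injective (RingHom.injective_int _)
  have hloc : ∀ x : ℚ ⊗[ℤ] B, ∃ N : ℤ, N ≠ 0 ∧ ∃ b : B, (N : ℚ ⊗[ℤ] B) * x = ι b := by
    intro x
    induction x with
    | zero => exact ⟨1, one_ne_zero, 0, by simp⟩
    | tmul q b =>
      refine ⟨q.den, by exact_mod_cast q.den_nz, q.num * b, ?_⟩
      change _ = (1 : ℚ) ⊗ₜ[ℤ] (_ : B)
      have h1 : ((q.den : ℤ) : ℚ ⊗[ℤ] B) = ((q.den : ℤ) : ℚ) ⊗ₜ[ℤ] (1 : B) := by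
        exact (map_intCast (Algebra.TensorProduct.includeLeft : ℚ →ₐ[ℤ] ℚ ⊗[ℤ] B) _).symm
      have h2 : ((q.den : ℤ) : ℚ) * q = q.num • (1 : ℚ) := by
        simp [Rat.den_mul_eq_num]
      rw [h1, Algebra.TensorProduct.tmul_mul_tmul, one_mul, h2, TensorProduct.smul_tmul,
        zsmul_eq_mul]
    | add x y hx hy =>
      obtain ⟨N, hN, b, hb⟩ := hx
      obtain ⟨N', hN', b', hb'⟩ := hy
      refine ⟨N * N', mul_ne_zero hN hN', N' * b + N * b', ?_⟩
      rw [map_add, map_mul, map_mul, ← hb, ← hb', map_intCast, map_intCast]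
      push_cast
      ring
  obtain ⟨n, g, hg, hgfin⟩ := exists_finite_inj_algHom_of_fg ℚ (ℚ ⊗[ℤ] B)
  choose Nt hNt t ht using fun i : Fin n => hloc (g (MvPolynomial.X i))
  let τ : MvPolynomial (Fin n) ℤ →+* B := (MvPolynomial.aeval (R := ℤ) t).toRingHom
  obtain ⟨g', hg'inj, hg'fin, hg'⟩ : ∃ g' : MvPolynomial (Fin n) ℚ →ₐ[ℚ] (ℚ ⊗[ℤ] B),
      Function.Injective g' ∧ g'.Finite ∧ ∀ i, g' (MvPolynomial.X i) = ι (t i) := by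
    let σ : MvPolynomial (Fin n) ℚ ≃ₐ[ℚ] MvPolynomial (Fin n) ℚ := AlgEquiv.ofAlgHom
      (MvPolynomial.aeval fun i => MvPolynomial.C (Nt i : ℚ) * MvPolynomial.X i)
      (MvPolynomial.aeval fun i => MvPolynomial.C ((Nt i : ℚ)⁻¹) * MvPolynomial.X i)
      (by
        apply MvPolynomial.algHom_ext
        intro i
        have : (Nt i : ℚ) ≠ 0 := by exact_mod_cast hNt i
        rw [AlgHom.comp_apply, MvPolynomial.aeval_X, map_mul, MvPolynomial.aeval_X,
          MvPolynomial.algHom_C, MvPolynomial.algebraMap_eq, ← mul_assoc, ← MvPolynomial.C_mul]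
        simp [this])
      (by
        apply MvPolynomial.algHom_ext
        intro i
        have : (Nt i : ℚ) ≠ 0 := by exact_mod_cast hNt i
        rw [AlgHom.comp_apply, MvPolynomial.aeval_X, map_mul, MvPolynomial.aeval_X,
          MvPolynomial.algHom_C, MvPolynomial.algebraMap_eq, ← mul_assoc, ← MvPolynomial.C_mul]
        simp [this])
    refine ⟨g.comp σ.toAlgHom, hg.comp σ.injective, ?_, fun i => ?_⟩
    · exact RingHom.Finite.comp hgfin (RingHom.Finite.of_surjective _ σ.surjective)
    · rw [← ht]
      simp [σ]
  have hn : n ≤ s := aux_dim g'.toRingHom hg'inj hg'fin hdim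
  have hcomm : ∀ q : MvPolynomial (Fin n) ℤ,
      g' (MvPolynomial.map (Int.castRingHom ℚ) q) = ι (τ q) := by
    intro q
    have : (g'.toRingHom.comp (MvPolynomial.map (Int.castRingHom ℚ))) = ι.comp τ := by
      ext i
      · simp
      · simp [hg', τ]
    exact congrArg (fun z => z q) this
  obtain ⟨m, b, hb⟩ : ∃ (m : ℕ) (b : Fin m → B), ∀ z : ℚ ⊗[ℤ] B,
      ∃ c : Fin m → MvPolynomial (Fin n) ℚ, z = ∑ l, g' (c l) * ι (b l) := by
    obtain ⟨m, e, he⟩ : ∃ (m : ℕ) (e : Fin m → ℚ ⊗[ℤ] B), ∀ z : ℚ ⊗[ℤ] B,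
      ∃ c : Fin m → MvPolynomial (Fin n) ℚ, z = ∑ l, g' (c l) * e l := by
      let := g'.toRingHom.toAlgebra
      have : Module.Finite (MvPolynomial (Fin n) ℚ) (ℚ ⊗[ℤ] B) := hg'fin
      obtain ⟨m, e, he⟩ := Module.Finite.exists_fin (R := MvPolynomial (Fin n) ℚ) (M := ℚ ⊗[ℤ] B)
      refine ⟨m, e, fun z => ?_⟩
      have hz : z ∈ Submodule.span (MvPolynomial (Fin n) ℚ) (Set.range e) := by rw [he]; trivial
      obtain ⟨c, hc⟩ := (Submodule.mem_span_range_iff_exists_fun _).mp hz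
      exact ⟨c, hc.symm⟩
    choose Ne hNe b hb using fun i : Fin m => hloc (e i)
    refine ⟨m, b, fun z => ?_⟩
    obtain ⟨c, hc⟩ := he z
    refine ⟨fun l => MvPolynomial.C ((Ne l : ℚ)⁻¹) * c l, ?_⟩
    rw [hc]
    refine Finset.sum_congr rfl fun l _ => ?_
    have h0 : (Ne l : ℚ) ≠ 0 := by exact_mod_cast hNe l
    have h1 : g' (MvPolynomial.C ((Ne l : ℚ)⁻¹)) * (Ne l : ℚ ⊗[ℤ] B) = 1 := by
      have : (Ne l : ℚ ⊗[ℤ] B) = g' (MvPolynomial.C (Ne l : ℚ)) := by simp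
      rw [this, ← map_mul, ← MvPolynomial.C_mul, inv_mul_cancel₀ h0]
      simp
    rw [← hb, map_mul]
    linear_combination (-(g' (c l) * e l)) * h1
  have hfam : ∀ {J : Type} [Finite J] (z : J → B), ∃ N : ℤ, N ≠ 0 ∧
      ∃ c : J → Fin m → MvPolynomial (Fin n) ℤ, ∀ j, (N : B) * z j = ∑ l, τ (c j l) * b l := by
    intro J _ z
    choose c hc using fun j => hb (ι (z j))
    obtain ⟨N, hN, c', hc'⟩ := aux_clear (fun jl : J × Fin m => c jl.1 jl.2)
    refine ⟨N, hN, fun j l => c' (j, l), fun j => hι ?_⟩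
    rw [map_mul, hc j, map_sum, Finset.mul_sum]
    refine Finset.sum_congr rfl fun l _ => ?_
    rw [map_mul, ← hcomm, hc', map_mul]
    simp [mul_assoc]
  have hτinj : Function.Injective τ := by
    intro u v huv
    have : ι (τ u) = ι (τ v) := by rw [huv]
    rw [← hcomm, ← hcomm] at this
    exact MvPolynomial.map_injective _ (RingHom.injective_int _) (hg'inj this)
  have hone : ∀ a : B, (∀ j, a * b j = 0) → a = 0 := by
    intro a ha
    obtain ⟨N, hN, c, hc⟩ := hfam (fun _ : Unit => (1 : B))
    have h1 : (N : B) * a = 0 := by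
      have := hc ()
      rw [mul_one] at this
      rw [this, mul_comm, Finset.mul_sum]
      exact Finset.sum_eq_zero fun j _ => by rw [mul_left_comm, ha, mul_zero]
    exact (mul_eq_zero.mp h1).resolve_left (by exact_mod_cast hN)
  refine ⟨n, t, hn, hτinj, ?_, m, b, ?_⟩
  · intro x
    obtain ⟨N, hN, c, hc⟩ := hfam (fun j : Fin m => x * b j)
    have h1 := aux_cayley t b hone ((N : B) * x) (Matrix.of c) (fun j => by
      rw [mul_assoc, hc]
      rfl)
    refine ⟨(Matrix.of c).charpoly.comp (Polynomial.C (N : MvPolynomial (Fin n) ℤ) * Polynomial.X),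
      ?_, ?_⟩
    · rw [Ne, Polynomial.comp_eq_zero_iff]
      rintro (h | ⟨-, h⟩)
      · exact (Matrix.charpoly_monic _).ne_zero h
      · have := congrArg (fun z => Polynomial.coeff z 1) h
        simp [hN] at this
    · rw [Polynomial.eval₂_comp, Polynomial.eval₂_mul, Polynomial.eval₂_C, Polynomial.eval₂_X,
        map_intCast]
      exact h1
  · obtain ⟨N, hN, c, hc⟩ := hfam (J := (Fin r × Fin m) ⊕ Unit)
      (Sum.elim (fun ij => y ij.1 * b ij.2) (fun _ => 1))
    refine ⟨N, fun i j l => c (Sum.inl (i, j)) l, fun l => τ (c (Sum.inr ()) l), hN, ?_, ?_⟩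
    · intro i j
      exact hc (Sum.inl (i, j))
    · have := hc (Sum.inr ())
      simpa using this

theorem aux_tensor_eq {p : ℕ} [Fact p.Prime] {B : Type*} [CommRing B] (z : ZMod p ⊗[ℤ] B) :
    ∃ b : B, z = (1 : ZMod p) ⊗ₜ[ℤ] b := by
  induction z with
  | zero => exact ⟨0, by simp⟩
  | tmul c b =>
    refine ⟨(c.val : ℤ) • b, ?_⟩
    rw [← TensorProduct.smul_tmul]
    congr 1
    simp
  | add x y hx hy =>
    obtain ⟨b, rfl⟩ := hx
    obtain ⟨b', rfl⟩ := hy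
    exact ⟨b + b', by rw [TensorProduct.tmul_add]⟩

theorem aux_tensor_zero {p : ℕ} [Fact p.Prime] {B : Type*} [CommRing B] (b : B) :
    (1 : ZMod p) ⊗ₜ[ℤ] b = 0 ↔ (p : B) ∣ b := by
  constructor
  · intro h
    let Q := B ⧸ Ideal.span {(p : B)}
    have hp : (p : Q) = 0 := by
      have : (p : Q) = Ideal.Quotient.mk (Ideal.span {(p : B)}) (p : B) := by simp [Q]
      rw [this, Ideal.Quotient.eq_zero_iff_mem]
      exact Ideal.mem_span_singleton_self _
    obtain ⟨e, he⟩ := CharP.exists Q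
    let φ : ZMod p →ₐ[ℤ] Q :=
      (ZMod.castHom ((CharP.cast_eq_zero_iff Q e p).mp hp) Q).toIntAlgHom
    let ψ : ZMod p ⊗[ℤ] B →ₐ[ℤ] Q := Algebra.TensorProduct.lift φ
      (Ideal.Quotient.mkₐ ℤ (Ideal.span {(p : B)})) (fun _ _ => Commute.all _ _)
    have h1 : ψ ((1 : ZMod p) ⊗ₜ[ℤ] b) = Ideal.Quotient.mk (Ideal.span {(p : B)}) b := by
      refine (Algebra.TensorProduct.lift_tmul _ _ _ _ _).trans ?_
      rw [map_one, one_mul]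
      rfl
    rw [h, map_zero] at h1
    exact Ideal.mem_span_singleton.mp (Ideal.Quotient.eq_zero_iff_mem.mp h1.symm)
  · rintro ⟨c, rfl⟩
    have : (p : B) * c = (p : ℤ) • c := by simp
    rw [this, ← TensorProduct.smul_tmul]
    simp

theorem aux_tensor_aeval {p n : ℕ} [Fact p.Prime] {B : Type*} [CommRing B] (t : Fin n → B)
    (q : MvPolynomial (Fin n) ℤ) :
    MvPolynomial.aeval (fun i => (1 : ZMod p) ⊗ₜ[ℤ] t i)
      (MvPolynomial.map (Int.castRingHom (ZMod p)) q) =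
        (1 : ZMod p) ⊗ₜ[ℤ] (MvPolynomial.aeval t q) := by
  have : ((MvPolynomial.aeval (R := ZMod p) (fun i => (1 : ZMod p) ⊗ₜ[ℤ] t i)).toRingHom.comp
      (MvPolynomial.map (Int.castRingHom (ZMod p)))) =
      (Algebra.TensorProduct.includeRight : B →ₐ[ℤ] ZMod p ⊗[ℤ] B).toRingHom.comp
        (MvPolynomial.aeval t).toRingHom := by
    ext i
    · simp
    · simp
  exact congrArg (fun z => z q) this

/-- **Lemma (point counts for hypersurface sections of an affine scheme mod p).**
Let `B` be a flat `ℤ`-algebra, presented by a surjection `π : ℤ[Y₁, …, Y_r] → B`, with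
`B ⊗ ℚ̄` a domain and `B ⊗ ℚ` of Krull dimension `s ≥ 1`. Then there is a constant `C > 0`
such that for every prime `p`, every `d ≥ 1` and every nonzero `f ∈ B ⊗ 𝔽_p` which is the
image of a polynomial of total degree `≤ d` under the base change of `π` to `𝔽_p`, the number
of `𝔽_p`-points of `Spec (B ⊗ 𝔽_p)` at which `f` vanishes is at most `C ⬝ d ⬝ p^(s-1)`. -/
theorem stmt_16 (r : ℕ) (hr : 1 ≤ r) (B : Type) [CommRing B]
    (π : MvPolynomial (Fin r) ℤ →+* B) (hπ : Function.Surjective π)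
    [Module.Flat ℤ B]
    [IsDomain ((AlgebraicClosure ℚ) ⊗[ℤ] B)]
    (s : ℕ) (hs : 1 ≤ s) (hdim : ringKrullDim (ℚ ⊗[ℤ] B) = (s : WithBot (WithTop ℕ))) :
    ∃ C : ℝ, 0 < C ∧
      ∀ (p : ℕ) [Fact p.Prime], ∀ d : ℕ, 1 ≤ d →
        ∀ f : (ZMod p) ⊗[ℤ] B, f ≠ 0 →
          (∃ g : MvPolynomial (Fin r) (ZMod p), g.totalDegree ≤ d ∧
            MvPolynomial.aeval (fun i => (1 : ZMod p) ⊗ₜ[ℤ] π (MvPolynomial.X i)) g = f) →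
          (Nat.card {φ : ((ZMod p) ⊗[ℤ] B) →ₐ[ZMod p] ZMod p // φ f = 0} : ℝ) ≤
            C * (d : ℝ) * (p : ℝ) ^ (s - 1) := by
  have hι : Function.Injective
      (Algebra.TensorProduct.includeRight : B →ₐ[ℤ] (AlgebraicClosure ℚ) ⊗[ℤ] B) :=
    Algebra.TensorProduct.includeRight_injective (RingHom.injective_int _)
  have : IsDomain B := hι.isDomain _
  have hBQ : IsDomain (ℚ ⊗[ℤ] B) := by
    let κ : ℚ ⊗[ℤ] B →ₐ[ℤ] (AlgebraicClosure ℚ) ⊗[ℤ] B :=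
      Algebra.TensorProduct.map ((Algebra.ofId ℚ (AlgebraicClosure ℚ)).restrictScalars ℤ)
        (AlgHom.id ℤ B)
    have hκ : Function.Injective κ :=
      Module.Flat.rTensor_preserves_injective_linearMap (M := B)
        ((Algebra.ofId ℚ (AlgebraicClosure ℚ)).restrictScalars ℤ).toLinearMap
        (algebraMap ℚ (AlgebraicClosure ℚ)).injective
    exact hκ.isDomain κ
  have : CharZero B := by
    have : CharZero ((AlgebraicClosure ℚ) ⊗[ℤ] B) :=
      charZero_of_injective_algebraMap
        (algebraMap (AlgebraicClosure ℚ) ((AlgebraicClosure ℚ) ⊗[ℤ] B)).injective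
    refine ⟨fun a b hab => ?_⟩
    have := congrArg (Algebra.TensorProduct.includeRight : B →ₐ[ℤ] (AlgebraicClosure ℚ) ⊗[ℤ] B) hab
    simpa only [map_natCast, Nat.cast_inj] using this
  set y : Fin r → B := fun i => π (MvPolynomial.X i) with hydef
  have hπy : ∀ u, π u = MvPolynomial.aeval y u := by
    intro u
    have : π = (MvPolynomial.aeval (R := ℤ) y).toRingHom := by
      ext i
      · simp
      · simp [y]
    exact congrArg (fun z => z u) this
  have hft : Algebra.FiniteType ℤ B := by
    refine Algebra.FiniteType.of_surjective (MvPolynomial.aeval (R := ℤ) y) ?_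
    intro b
    obtain ⟨u, hu⟩ := hπ b
    exact ⟨u, by rw [← hπy, hu]⟩
  obtain ⟨n, t, hns, htinj, htalg, m, b, N₂, M, c, hN₂, hM, hc⟩ := aux_noether hdim y
  obtain ⟨N₁, hN₁, hgood⟩ : ∃ N : ℤ, N ≠ 0 ∧ ∀ p : ℕ, [Fact p.Prime] → ¬ (p : ℤ) ∣ N →
      ∀ f g : B, (p : B) ∣ f * g → (p : B) ∣ f ∨ (p : B) ∣ g := by
    let := (MvPolynomial.aeval (R := ℤ) t).toRingHom.toAlgebra
    have : FaithfulSMul (MvPolynomial (Fin n) ℤ) B :=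
      (faithfulSMul_iff_algebraMap_injective _ _).mpr htinj
    have : Algebra.IsAlgebraic (MvPolynomial (Fin n) ℤ) B := ⟨fun x => by
      obtain ⟨q, hq, hq0⟩ := htalg x
      exact ⟨q, hq, hq0⟩⟩
    exact aux_good (n := n)
  let D : ℕ := ∑ i, ∑ j, ∑ l, (M i j l).totalDegree
  have hD : ∀ i j l, (M i j l).totalDegree ≤ D := by
    intro i j l
    calc (M i j l).totalDegree ≤ ∑ l, (M i j l).totalDegree :=
          Finset.single_le_sum (f := fun l => (M i j l).totalDegree) (fun _ _ => Nat.zero_le _)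
            (Finset.mem_univ l)
      _ ≤ ∑ j, ∑ l, (M i j l).totalDegree :=
          Finset.single_le_sum (f := fun j => ∑ l, (M i j l).totalDegree)
            (fun _ _ => Nat.zero_le _) (Finset.mem_univ j)
      _ ≤ D :=
          Finset.single_le_sum (f := fun i => ∑ j, ∑ l, (M i j l).totalDegree)
            (fun _ _ => Nat.zero_le _) (Finset.mem_univ i)
  let W : ℕ := (N₁ * N₂).natAbs
  refine ⟨((m ^ r * m * D + W ^ r + 1 : ℕ) : ℝ), by positivity, ?_⟩
  intro p hp d hd f hf hg
  obtain ⟨q, hq, rfl⟩ := hg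
  suffices h : Nat.card {φ : ((ZMod p) ⊗[ℤ] B) →ₐ[ZMod p] ZMod p //
      φ (MvPolynomial.aeval (fun i => (1 : ZMod p) ⊗ₜ[ℤ] π (MvPolynomial.X i)) q) = 0} ≤
      (m ^ r * m * D + W ^ r + 1) * d * p ^ (s - 1) by
    exact_mod_cast h
  have hp0 : 0 < p := hp.out.pos
  have hysurj : Function.Surjective
      (MvPolynomial.aeval (R := ZMod p) (fun i => (1 : ZMod p) ⊗ₜ[ℤ] y i)) := by
    intro z
    obtain ⟨x, rfl⟩ := aux_tensor_eq z
    obtain ⟨u, hu⟩ := hπ x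
    exact ⟨MvPolynomial.map (Int.castRingHom (ZMod p)) u, by rw [aux_tensor_aeval, ← hπy, hu]⟩
  by_cases hbad : (p : ℤ) ∣ N₁ * N₂
  · have hpW : p ≤ W := by
      refine Nat.le_of_dvd ?_ (Int.natCast_dvd.mp hbad)
      exact Int.natAbs_pos.mpr (mul_ne_zero hN₁ hN₂)
    have hinj : Function.Injective (fun (φ : {φ : ((ZMod p) ⊗[ℤ] B) →ₐ[ZMod p] ZMod p //
      φ (MvPolynomial.aeval (fun i => (1 : ZMod p) ⊗ₜ[ℤ] π (MvPolynomial.X i)) q) = 0})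
        (i : Fin r) => φ.1 ((1 : ZMod p) ⊗ₜ[ℤ] y i)) := by
      intro φ φ' h
      apply Subtype.ext
      apply AlgHom.ext
      intro a
      obtain ⟨u, rfl⟩ := hysurj a
      have : φ.1.comp (MvPolynomial.aeval (fun i => (1 : ZMod p) ⊗ₜ[ℤ] y i)) =
          φ'.1.comp (MvPolynomial.aeval (fun i => (1 : ZMod p) ⊗ₜ[ℤ] y i)) := by
        apply MvPolynomial.algHom_ext
        intro i
        simpa using congrFun h i
      exact congrArg (fun z => z u) this
    have h1 := Nat.card_le_card_of_injective _ hinj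
    have h2 : Nat.card (Fin r → ZMod p) = p ^ r := by simp
    rw [h2] at h1
    calc _ ≤ p ^ r := h1
      _ ≤ W ^ r := Nat.pow_le_pow_left hpW r
      _ ≤ m ^ r * m * D + W ^ r + 1 := by lia
      _ ≤ (m ^ r * m * D + W ^ r + 1) * d := Nat.le_mul_of_pos_right _ hd
      _ ≤ _ := Nat.le_mul_of_pos_right _ (pow_pos hp0 _)
  · have hb1 : ¬ (p : ℤ) ∣ N₁ := fun h => hbad (Dvd.dvd.mul_right h _)
    have hb2 : ¬ (p : ℤ) ∣ N₂ := fun h => hbad (Dvd.dvd.mul_left h _)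
    have hN0 : (N₂ : ZMod p) ≠ 0 := by
      rwa [Ne, ZMod.intCast_zmod_eq_zero_iff_dvd]
    have hNZ : NoZeroDivisors (ZMod p ⊗[ℤ] B) := by
      refine ⟨fun {x z} hxz => ?_⟩
      obtain ⟨x, rfl⟩ := aux_tensor_eq x
      obtain ⟨z, rfl⟩ := aux_tensor_eq z
      rw [Algebra.TensorProduct.tmul_mul_tmul, one_mul, aux_tensor_zero] at hxz
      rw [aux_tensor_zero, aux_tensor_zero]
      exact hgood p hb1 x z hxz
    have hinv : algebraMap (ZMod p) (ZMod p ⊗[ℤ] B) ((N₂ : ZMod p)⁻¹) *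
        ((1 : ZMod p) ⊗ₜ[ℤ] (N₂ : B)) = 1 := by
      have : (1 : ZMod p) ⊗ₜ[ℤ] (N₂ : B) = algebraMap (ZMod p) (ZMod p ⊗[ℤ] B) (N₂ : ZMod p) := by
        rw [map_intCast]
        exact map_intCast (Algebra.TensorProduct.includeRight : B →ₐ[ℤ] ZMod p ⊗[ℤ] B) _
      rw [this, ← map_mul, inv_mul_cancel₀ hN0, map_one]
    have hsum : ∀ u v : Fin m → B, (1 : ZMod p) ⊗ₜ[ℤ] (∑ l, u l * v l) =
        ∑ l, ((1 : ZMod p) ⊗ₜ[ℤ] u l) * ((1 : ZMod p) ⊗ₜ[ℤ] v l) := by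
      intro u v
      rw [TensorProduct.tmul_sum]
      simp
    have hcount := aux_count (k := ZMod p) (D := D) (d := d) (fun i => (1 : ZMod p) ⊗ₜ[ℤ] y i) hysurj
      (fun i => (1 : ZMod p) ⊗ₜ[ℤ] t i) (fun i => (1 : ZMod p) ⊗ₜ[ℤ] b i) (by
        intro a ha
        have h1 : a * ((1 : ZMod p) ⊗ₜ[ℤ] (N₂ : B)) = 0 := by
          rw [hc, hsum, Finset.mul_sum]
          exact Finset.sum_eq_zero fun l _ => by rw [mul_left_comm, ha, mul_zero]
        calc a = a * ((1 : ZMod p) ⊗ₜ[ℤ] (N₂ : B)) *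
              algebraMap (ZMod p) (ZMod p ⊗[ℤ] B) ((N₂ : ZMod p)⁻¹) := by
                rw [mul_assoc, mul_comm ((1 : ZMod p) ⊗ₜ[ℤ] (N₂ : B)), hinv, mul_one]
          _ = 0 := by rw [h1, zero_mul])
      (by
        intro i
        refine ⟨fun j l => MvPolynomial.C ((N₂ : ZMod p)⁻¹) *
          MvPolynomial.map (Int.castRingHom (ZMod p)) (M i j l), fun j l => ?_, fun j => ?_⟩
        · refine (MvPolynomial.totalDegree_mul _ _).trans ?_
          rw [MvPolynomial.totalDegree_C, zero_add]
          exact le_trans (Finset.sup_mono (MvPolynomial.support_map_subset _ _)) (hD i j l)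
        · have h1 := congrArg (fun z => (1 : ZMod p) ⊗ₜ[ℤ] z) (hM i j)
          have h1 := h1.trans (hsum _ _)
          simp_rw [map_mul, aux_tensor_aeval, mul_assoc]
          rw [MvPolynomial.algHom_C, ← Finset.mul_sum, ← h1]
          have h2 : (1 : ZMod p) ⊗ₜ[ℤ] ((N₂ : B) * (y i * b j)) =
            ((1 : ZMod p) ⊗ₜ[ℤ] (N₂ : B)) *
              (((1 : ZMod p) ⊗ₜ[ℤ] y i) * ((1 : ZMod p) ⊗ₜ[ℤ] b j)) := by simp
          rw [h2, ← mul_assoc, hinv, one_mul])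
      q hq hf
    rw [ZMod.card] at hcount
    have hps : p ^ n ≤ p ^ (s - 1) * p := by
      rw [← pow_succ]
      exact Nat.pow_le_pow_right hp0 (by lia)
    have h3 : Nat.card {φ : ((ZMod p) ⊗[ℤ] B) →ₐ[ZMod p] ZMod p //
      φ (MvPolynomial.aeval (fun i => (1 : ZMod p) ⊗ₜ[ℤ] π (MvPolynomial.X i)) q) = 0} * p ≤
        ((m ^ r * (m * (d * D))) * p ^ (s - 1)) * p := by
      refine hcount.trans ?_
      rw [mul_assoc _ (p ^ (s - 1)) p]
      exact Nat.mul_le_mul_left _ hps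
    refine (Nat.le_of_mul_le_mul_right h3 hp0).trans (Nat.mul_le_mul_right _ ?_)
    calc m ^ r * (m * (d * D)) = (m ^ r * m * D) * d := by ring
      _ ≤ _ := Nat.mul_le_mul_right _ (by lia)
end
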